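/- arXiv:2504.14511 — 4 statements merged into one kernel-verified Lean document; each statement's English description precedes it below -/
import Mathlib

section
/- The 1/10-quasi-Riemann hypothesis holds if and only if for every ε > 0 there is a constant C_ε > 0 such that |∑_{n ≤ x} μ(n)| ≤ C_ε · x^{3/5 + ε} for all x ≥ 1. -/
/-- The `r`-quasi-Riemann hypothesis: every nontrivial zero `s` of the Riemann zeta
function satisfies `1/2 - r ≤ Re s ≤ 1/2 + r`. -/
def QRH (r : ℝ) : Prop :=
  ∀ s : ℂ, riemannZeta s = 0 → (¬ ∃ n : ℕ, s = -2 * ((n : ℂ) + 1)) →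
    1/2 - r ≤ s.re ∧ s.re ≤ 1/2 + r

section

open Complex Set MeasureTheory Filter Topology Asymptotics Metric

theorem norm_mul_cpow_neg_le {f : ℝ → ℂ} {C a : ℝ} (hfC : ∀ t, 1 < t → ‖f t‖ ≤ C * t ^ a)
    (s : ℂ) {t : ℝ} (ht : 1 < t) :
    ‖f t * (t : ℂ) ^ (-(s + 1))‖ ≤ C * t ^ (a - s.re - 1) := by
  have ht0 : 0 < t := by linarith
  rw [norm_mul, norm_cpow_eq_rpow_re_of_pos ht0]
  calc _ ≤ C * t ^ a * t ^ (-(s + 1)).re := by gcongr; exact hfC t ht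
    _ = _ := by rw [mul_assoc, ← Real.rpow_add ht0]; congr 2; simp; ring

theorem norm_integral_mul_cpow_neg_le {f : ℝ → ℂ} {C a : ℝ}
    (hfC : ∀ t, 1 < t → ‖f t‖ ≤ C * t ^ a) {s : ℂ} (hs : a < s.re) :
    ‖∫ t in Ioi (1 : ℝ), f t * (t : ℂ) ^ (-(s + 1))‖ ≤ C / (s.re - a) := by
  have hi : IntegrableOn (fun t : ℝ ↦ C * t ^ (a - s.re - 1)) (Ioi 1) :=
    (integrableOn_Ioi_rpow_of_lt (by linarith) one_pos).const_mul C
  refine (norm_integral_le_of_norm_le hi ?_).trans ?_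
  · filter_upwards [ae_restrict_mem measurableSet_Ioi] with t ht
    exact norm_mul_cpow_neg_le hfC s ht
  · rw [integral_const_mul, integral_Ioi_rpow_of_lt (by linarith) one_pos, Real.one_rpow,
      sub_add_cancel, ← neg_sub s.re a, neg_div_neg_eq, mul_one_div]

theorem integrableOn_mul_cpow_neg {f : ℝ → ℂ} (hf : Measurable f) {C a : ℝ}
    (hfC : ∀ t, 1 < t → ‖f t‖ ≤ C * t ^ a) {s : ℂ} (hs : a < s.re) :
    IntegrableOn (fun t : ℝ ↦ f t * (t : ℂ) ^ (-(s + 1))) (Ioi 1) := by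
  have hi : IntegrableOn (fun t : ℝ ↦ C * t ^ (a - s.re - 1)) (Ioi 1) :=
    (integrableOn_Ioi_rpow_of_lt (by linarith) one_pos).const_mul C
  refine hi.mono' (Measurable.aestronglyMeasurable (by fun_prop)) ?_
  filter_upwards [ae_restrict_mem measurableSet_Ioi] with t ht
  exact norm_mul_cpow_neg_le hfC s ht

theorem differentiableAt_integral_mul_cpow_neg {f : ℝ → ℂ} (hf : Measurable f) {C a : ℝ}
    (hfC : ∀ t, 1 < t → ‖f t‖ ≤ C * t ^ a) {s : ℂ} (hs : a < s.re) :
    DifferentiableAt ℂ (fun s : ℂ ↦ ∫ t in Ioi (1 : ℝ), f t * (t : ℂ) ^ (-(s + 1))) s := by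
  set g : ℝ → ℂ := (Ioi 1).indicator f with hg
  have hgm : Measurable g := hf.indicator measurableSet_Ioi
  have heq (s : ℂ) : ∫ t in Ioi (1 : ℝ), f t * (t : ℂ) ^ (-(s + 1)) = mellin g (-s) := by
    rw [mellin, ← integral_indicator measurableSet_Ioi, ← integral_indicator measurableSet_Ioi]
    congr 1 with t
    by_cases h1 : 1 < t
    · rw [indicator_of_mem (mem_Ioi.2 h1), indicator_of_mem (mem_Ioi.2 (by linarith)), hg,
        indicator_of_mem (mem_Ioi.2 h1), smul_eq_mul, mul_comm]
      ring_nf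
    · simp [hg, indicator, h1]
  have hfC' (t : ℝ) (ht : 0 < t) : ‖g t‖ ≤ |C| * t ^ a := by
    by_cases h1 : 1 < t
    · rw [hg, indicator_of_mem (mem_Ioi.2 h1)]
      exact (hfC t h1).trans (by gcongr; exact le_abs_self C)
    · rw [hg, indicator_of_notMem (by simpa using h1), norm_zero]; positivity
  simp_rw [heq]
  refine DifferentiableAt.comp s (g := mellin g) ?_ differentiableAt_id.neg
  refine mellin_differentiableAt_of_isBigO_rpow (a := -a) (b := (-s).re - 1) ?_ ?_
    (by simpa using hs) ?_ (by linarith)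
  · refine (locallyIntegrableOn_iff isLocallyClosed_Ioi).2 fun K hK hKc ↦ ?_
    have hc : ContinuousOn (fun t : ℝ ↦ |C| * t ^ a) K :=
      (continuousOn_id.rpow_const fun t ht ↦ Or.inl (hK ht).ne').const_mul _
    refine (hc.integrableOn_compact hKc).mono' hgm.aestronglyMeasurable ?_
    filter_upwards [ae_restrict_mem hKc.measurableSet] with t ht using hfC' t (hK ht)
  · refine IsBigO.of_bound |C| ?_
    filter_upwards [eventually_gt_atTop 0] with t ht
    rw [neg_neg, Real.norm_of_nonneg (by positivity)]
    exact hfC' t ht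
  · refine (EventuallyEq.trans_isBigO ?_ (isBigO_zero _ _))
    filter_upwards [Ioo_mem_nhdsGT (one_pos (α := ℝ))] with t ht
    simp [hg, ht.2.le]

theorem eqOn_re_gt_of_eqOn_re_gt_one {f g : ℂ → ℂ} {a : ℝ}
    (hf : ∀ s : ℂ, a < s.re → DifferentiableAt ℂ f s)
    (hg : ∀ s : ℂ, a < s.re → DifferentiableAt ℂ g s) (hfg : ∀ s : ℂ, 1 < s.re → f s = g s)
    {s : ℂ} (hs : a < s.re) : f s = g s := by
  have hU : IsOpen {s : ℂ | a < s.re} := isOpen_lt continuous_const continuous_re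
  have hfa : AnalyticOnNhd ℂ f {s : ℂ | a < s.re} :=
    DifferentiableOn.analyticOnNhd (fun z hz ↦ (hf z hz).differentiableWithinAt) hU
  have hga : AnalyticOnNhd ℂ g {s : ℂ | a < s.re} :=
    DifferentiableOn.analyticOnNhd (fun z hz ↦ (hg z hz).differentiableWithinAt) hU
  refine hfa.eqOn_of_preconnected_of_eventuallyEq hga (convex_halfSpace_re_gt a).isPreconnected
    (z₀ := ((max a 1 + 1 : ℝ) : ℂ)) ?_ ?_ hs
  · simp only [mem_ofPred_eq, ofReal_re]; linarith [le_max_left a 1]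
  · have : {s : ℂ | 1 < s.re} ∈ 𝓝 ((max a 1 + 1 : ℝ) : ℂ) :=
      (isOpen_lt continuous_const continuous_re).mem_nhds
        (by simp only [mem_ofPred_eq, ofReal_re]; linarith [le_max_right a 1])
    filter_upwards [this] with z hz using hfg z hz

theorem riemannZeta_eq_mul_integral_floor {s : ℂ} (hs : 1 < s.re) :
    riemannZeta s = s * ∫ t in Ioi (1 : ℝ), (⌊t⌋₊ : ℂ) * (t : ℂ) ^ (-(s + 1)) := by
  rw [← LSeries_one_eq_riemannZeta hs, LSeries_eq_mul_integral' 1 zero_le_one hs]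
  · simp
  · simp only [Pi.one_apply, norm_one, Finset.sum_const, Nat.card_Icc, add_tsub_cancel_right,
      nsmul_eq_mul, mul_one, Real.rpow_one]
    exact isBigO_refl _ _

theorem norm_fract_le_mul_rpow_zero (t : ℝ) (_ : 1 < t) :
    ‖((Int.fract t : ℝ) : ℂ)‖ ≤ 1 * t ^ (0 : ℝ) := by
  rw [norm_real, Real.norm_of_nonneg (Int.fract_nonneg t), Real.rpow_zero, one_mul]
  exact (Int.fract_lt_one t).le

theorem measurable_ofReal_fract : Measurable fun t : ℝ ↦ ((Int.fract t : ℝ) : ℂ) :=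
  measurable_ofReal.comp measurable_fract

theorem riemannZeta₁_eq_of_one_lt_re {s : ℂ} (hs : 1 < s.re) :
    riemannZeta₁ s =
      s - s * (s - 1) * ∫ t in Ioi (1 : ℝ), ((Int.fract t : ℝ) : ℂ) * (t : ℂ) ^ (-(s + 1)) := by
  have hs1 : s ≠ 1 := by rintro rfl; simp at hs
  have h1 : IntegrableOn (fun t : ℝ ↦ ((Int.fract t : ℝ) : ℂ) * (t : ℂ) ^ (-(s + 1))) (Ioi 1) :=
    integrableOn_mul_cpow_neg measurable_ofReal_fract norm_fract_le_mul_rpow_zero (by linarith)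
  have h2 : IntegrableOn (fun t : ℝ ↦ (t : ℂ) ^ (-s)) (Ioi 1) :=
    integrableOn_Ioi_cpow_of_lt (by simpa using hs) one_pos
  have h3 : ∫ t in Ioi (1 : ℝ), (⌊t⌋₊ : ℂ) * (t : ℂ) ^ (-(s + 1)) =
      (s - 1)⁻¹ - ∫ t in Ioi (1 : ℝ), ((Int.fract t : ℝ) : ℂ) * (t : ℂ) ^ (-(s + 1)) := by
    have h4 : ∫ t in Ioi (1 : ℝ), (t : ℂ) ^ (-s) = (s - 1)⁻¹ := by
      rw [integral_Ioi_cpow_of_lt (by simpa using hs) one_pos, ofReal_one, one_cpow,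
        neg_div, ← one_div, ← div_neg]
      ring_nf
    rw [← h4, ← integral_sub h2 h1]
    refine setIntegral_congr_fun measurableSet_Ioi fun t ht ↦ ?_
    have ht0 : (0 : ℝ) < t := one_pos.trans ht
    have h5 : (t : ℂ) ^ (-s) = t * (t : ℂ) ^ (-(s + 1)) := by
      rw [show -s = 1 + -(s + 1) by ring, cpow_add _ _ (by exact_mod_cast ht0.ne'), cpow_one]
    have h6 : (⌊t⌋₊ : ℂ) = ((t - Int.fract t : ℝ) : ℂ) := by
      rw [Int.self_sub_fract, ← natCast_floor_eq_intCast_floor ht0.le]; simp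
    simp only [h5, h6]
    push_cast; ring
  have h7 := riemannZeta_eq_inv_sub_mul hs1
  rw [riemannZeta_eq_mul_integral_floor hs, h3] at h7
  have h8 : s - 1 ≠ 0 := sub_ne_zero.2 hs1
  field_simp at h7
  linear_combination -h7

theorem riemannZeta₁_eq_of_re_pos {s : ℂ} (hs : 0 < s.re) :
    riemannZeta₁ s =
      s - s * (s - 1) * ∫ t in Ioi (1 : ℝ), ((Int.fract t : ℝ) : ℂ) * (t : ℂ) ^ (-(s + 1)) := by
  refine eqOn_re_gt_of_eqOn_re_gt_one (fun s _ ↦ differentiable_riemannZeta₁ s) (fun s hs ↦ ?_)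
    (fun s hs ↦ riemannZeta₁_eq_of_one_lt_re hs) hs
  have := differentiableAt_integral_mul_cpow_neg measurable_ofReal_fract
    norm_fract_le_mul_rpow_zero hs
  fun_prop

theorem norm_riemannZeta_le {s : ℂ} (hs : 1 / 2 ≤ s.re) (hs1 : 1 ≤ ‖s - 1‖) :
    ‖riemannZeta s‖ ≤ 3 * ‖s‖ := by
  have hne : s - 1 ≠ 0 := norm_pos_iff.1 (one_pos.trans_le hs1)
  have hI := norm_integral_mul_cpow_neg_le norm_fract_le_mul_rpow_zero (s := s) (by linarith)
  rw [riemannZeta_eq_inv_sub_mul (sub_ne_zero.1 hne), riemannZeta₁_eq_of_re_pos (by linarith)]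
  set J := ∫ t in Ioi (1 : ℝ), ((Int.fract t : ℝ) : ℂ) * (t : ℂ) ^ (-(s + 1))
  have hJ : ‖J‖ ≤ 2 := hI.trans (by rw [sub_zero, div_le_iff₀ (by linarith)]; linarith)
  have : (s - 1)⁻¹ * (s - s * (s - 1) * J) = s * ((s - 1)⁻¹ - J) := by field_simp
  rw [this, norm_mul, mul_comm]
  gcongr
  calc ‖(s - 1)⁻¹ - J‖ ≤ ‖(s - 1)⁻¹‖ + ‖J‖ := norm_sub_le _ _
    _ ≤ 1 + 2 := by gcongr; rw [norm_inv]; exact inv_le_one_of_one_le₀ hs1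
    _ = 3 := by norm_num

theorem inv_riemannZeta_eq_LSeries_moebius {s : ℂ} (hs : 1 < s.re) :
    (riemannZeta s)⁻¹ = LSeries (fun n ↦ ((ArithmeticFunction.moebius n : ℤ) : ℂ)) s := by
  have h := ArithmeticFunction.LSeries_zeta_mul_Lseries_moebius hs
  rw [ArithmeticFunction.LSeries_zeta_eq_riemannZeta hs] at h
  exact inv_eq_of_mul_eq_one_right h

theorem norm_moebius_le_one (n : ℕ) : ‖((ArithmeticFunction.moebius n : ℤ) : ℂ)‖ ≤ 1 := by
  rw [norm_intCast]
  exact_mod_cast ArithmeticFunction.abs_moebius_le_one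

theorem inv_riemannZeta_eq_mul_integral {s : ℂ} (hs : 1 < s.re) :
    (riemannZeta s)⁻¹ = s * ∫ t in Ioi (1 : ℝ),
      (∑ n ∈ Finset.Icc 1 ⌊t⌋₊, ((ArithmeticFunction.moebius n : ℤ) : ℂ)) *
        (t : ℂ) ^ (-(s + 1)) := by
  rw [inv_riemannZeta_eq_LSeries_moebius hs]
  refine LSeries_eq_mul_integral' _ zero_le_one hs (IsBigO.of_bound 1 (.of_forall fun n ↦ ?_))
  rw [Real.rpow_one, one_mul, Real.norm_of_nonneg (by positivity),
    Real.norm_of_nonneg (by positivity)]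
  refine (Finset.sum_le_sum fun k _ ↦ norm_moebius_le_one k).trans (by simp)

theorem riemannZeta_ne_zero_of_sum_moebius_le {C a : ℝ}
    (hC : ∀ x : ℝ, 1 ≤ x →
      |∑ n ∈ Finset.Icc 1 ⌊x⌋₊, ((ArithmeticFunction.moebius n : ℤ) : ℝ)| ≤ C * x ^ a)
    {s : ℂ} (hs : a < s.re) : riemannZeta s ≠ 0 := by
  set M : ℝ → ℂ := fun t ↦ ∑ n ∈ Finset.Icc 1 ⌊t⌋₊, ((ArithmeticFunction.moebius n : ℤ) : ℂ)
    with hM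
  have hMm : Measurable M :=
    (measurable_from_nat (f := fun N ↦ ∑ n ∈ Finset.Icc 1 N,
      ((ArithmeticFunction.moebius n : ℤ) : ℂ))).comp Nat.measurable_floor
  have hMC (t : ℝ) (ht : 1 < t) : ‖M t‖ ≤ C * t ^ a := by
    have : M t =
        ((∑ n ∈ Finset.Icc 1 ⌊t⌋₊, ((ArithmeticFunction.moebius n : ℤ) : ℝ) : ℝ) : ℂ) := by
      simp [hM]
    rw [this, norm_real]
    exact hC t ht.le
  have key : riemannZeta₁ s * (s * ∫ t in Ioi (1 : ℝ), M t * (t : ℂ) ^ (-(s + 1))) = s - 1 := by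
    refine eqOn_re_gt_of_eqOn_re_gt_one
      (f := fun s ↦ riemannZeta₁ s * (s * ∫ t in Ioi (1 : ℝ), M t * (t : ℂ) ^ (-(s + 1))))
      (g := fun s ↦ s - 1) (fun z hz ↦ ?_) (fun z _ ↦ by fun_prop) (fun z hz ↦ ?_) hs
    · have h1 := differentiableAt_integral_mul_cpow_neg hMm hMC hz
      have h2 := differentiable_riemannZeta₁ z
      fun_prop
    · have hz1 : z ≠ 1 := by rintro rfl; simp at hz
      have h1 := riemannZeta_eq_inv_sub_mul hz1
      have h2 := riemannZeta_ne_zero_of_one_lt_re hz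
      have h3 : z - 1 ≠ 0 := sub_ne_zero.2 hz1
      simp only [hM]
      rw [← inv_riemannZeta_eq_mul_integral hz]
      field_simp at h1 ⊢
      linear_combination -h1
  intro h0
  have hs1 : s ≠ 1 := by rintro rfl; exact riemannZeta_one_ne_zero h0
  have h3 : s - 1 ≠ 0 := sub_ne_zero.2 hs1
  rw [riemannZeta_eq_inv_sub_mul hs1, mul_eq_zero_iff_left (inv_ne_zero h3)] at h0
  rw [h0, zero_mul] at key
  exact h3 key.symm

theorem qrh_of_forall_riemannZeta_ne_zero {r : ℝ} (hr' : - 1 / 2 < r)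
    (h : ∀ s : ℂ, 1 / 2 + r < s.re → riemannZeta s ≠ 0) : QRH r := by
  intro s hs hns
  refine ⟨?_, not_lt.1 fun hlt ↦ h s hlt hs⟩
  by_contra! hlt
  set w := 1 - s with hw
  have hwre : 1 / 2 + r < w.re := by simp [hw]; linarith
  have hsw : s = 1 - w := by simp [hw]
  have hw1 : w ≠ 1 := by
    intro h1
    rw [hsw, h1, sub_self, riemannZeta_zero] at hs
    norm_num at hs
  have hwn (n : ℕ) : w ≠ -n := by
    intro hn
    rw [hn] at hwre
    simp at hwre
    have : (0 : ℝ) ≤ n := n.cast_nonneg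
    linarith
  rw [hsw, riemannZeta_one_sub hwn hw1] at hs
  have hG : Gamma w ≠ 0 := Gamma_ne_zero hwn
  have hp : (2 * (Real.pi : ℂ)) ^ (-w) ≠ 0 := by
    rw [Ne, cpow_eq_zero_iff]; simp [Real.pi_ne_zero]
  have hcos : cos (Real.pi * w / 2) = 0 := by
    simpa [hG, hp, h w hwre] using hs
  obtain ⟨k, hk⟩ := cos_eq_zero_iff.1 hcos
  have hpi : (Real.pi : ℂ) ≠ 0 := by exact_mod_cast Real.pi_ne_zero
  have hwk : w = 2 * k + 1 := by
    field_simp at hk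
    exact hk
  have hk0 : 0 ≤ k := by
    have : (0 : ℝ) < 2 * k + 1 := by
      have h2 : w.re = 2 * k + 1 := by rw [hwk]; simp
      linarith
    have : (0 : ℤ) < 2 * k + 1 := by exact_mod_cast this
    omega
  obtain ⟨m, rfl⟩ := Int.eq_ofNat_of_zero_le hk0
  rcases m with _ | m
  · exact hw1 (by simpa using hwk)
  · exact hns ⟨m, by rw [hsw, hwk]; push_cast; ring⟩

theorem qrh_of_sum_moebius_le {r : ℝ} (hr' : - 1 / 2 < r)
    (h : ∀ ε : ℝ, 0 < ε → ∃ C : ℝ, 0 < C ∧ ∀ x : ℝ, 1 ≤ x →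
      |∑ n ∈ Finset.Icc 1 ⌊x⌋₊, ((ArithmeticFunction.moebius n : ℤ) : ℝ)|
        ≤ C * x ^ (1 / 2 + r + ε)) : QRH r := by
  refine qrh_of_forall_riemannZeta_ne_zero hr' fun s hs ↦ ?_
  obtain ⟨C, -, hC⟩ := h ((s.re - (1 / 2 + r)) / 2) (by linarith)
  exact riemannZeta_ne_zero_of_sum_moebius_le hC (by linarith)

theorem exists_eq_mul_exp_of_ne_zero {f : ℂ → ℂ} {c : ℂ} {R : ℝ}
    (hf : DifferentiableOn ℂ f (ball c R)) (h0 : ∀ z ∈ ball c R, f z ≠ 0) :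
    ∃ g : ℂ → ℂ, DifferentiableOn ℂ g (ball c R) ∧ g c = 0 ∧
      ∀ z ∈ ball c R, f z = f c * exp (g z) := by
  have hfd (z) (hz : z ∈ ball c R) : HasDerivAt f (deriv f z) z :=
    (hf.differentiableAt (isOpen_ball.mem_nhds hz)).hasDerivAt
  have hl : DifferentiableOn ℂ (fun z ↦ deriv f z / f z) (ball c R) :=
    (hf.deriv isOpen_ball).div hf h0
  obtain ⟨g, hgc, hg⟩ := hl.isExactOn_ball.with_val_at c 0
  refine ⟨g, fun z hz ↦ (hg z hz).differentiableAt.differentiableWithinAt, hgc, fun z hz ↦ ?_⟩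
  have hd (z) (hz : z ∈ ball c R) : HasDerivAt (fun z ↦ f z * exp (-g z)) 0 z := by
    refine ((hfd z hz).mul (hg z hz).neg.cexp).congr_deriv ?_
    field_simp [h0 z hz]
    ring
  have hconst := (convex_ball c R).is_const_of_fderivWithin_eq_zero (𝕜 := ℂ)
    (f := fun z ↦ f z * exp (-g z)) (x := z) (y := c)
    (fun z hz ↦ (hd z hz).differentiableAt.differentiableWithinAt) (fun z hz ↦ by
      rw [fderivWithin_of_isOpen isOpen_ball hz]
      exact (hd z hz).hasFDerivAt.fderiv.trans (by ext; simp)) hz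
      (mem_ball_self (pos_of_mem_ball hz))
  simp only [hgc, neg_zero, exp_zero, mul_one] at hconst
  rw [← hconst, mul_assoc, ← exp_add, neg_add_cancel, exp_zero, mul_one]

theorem norm_le_of_re_le_of_ball {g : ℂ → ℂ} {c z : ℂ} {R r M : ℝ} (hM : 0 < M) (hrR : r < R)
    (hg : DifferentiableOn ℂ g (ball c R)) (hgM : ∀ z ∈ ball c R, (g z).re ≤ M)
    (hgc : g c = 0) (hz : ‖z - c‖ ≤ r) : ‖g z‖ ≤ 2 * M * r / (R - r) := by
  have hr : 0 ≤ r := (norm_nonneg _).trans hz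
  have hmaps : MapsTo (fun w ↦ c + w) (ball 0 R) (ball c R) := fun w hw ↦ by
    simpa using hw
  have h := borelCaratheodory_zero (f := fun w ↦ g (c + w)) (z := z - c) hM
    (hg.comp (by fun_prop) hmaps) (fun w hw ↦ hgM _ (hmaps hw)) (hr.trans_lt hrR)
    (by simpa using hz.trans_lt hrR) (by simpa using hgc)
  simp only [add_sub_cancel] at h
  refine h.trans ?_
  have : 0 < R - r := by linarith
  gcongr

theorem norm_le_of_three_circles {g : ℂ → ℂ} {c z : ℂ} {R r₁ r₃ M₁ M₃ : ℝ} (hr₁ : 0 < r₁)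
    (h13 : r₁ < r₃) (h3R : r₃ < R) (hg : DifferentiableOn ℂ g (ball c R))
    (h1 : ∀ z, ‖z - c‖ = r₁ → ‖g z‖ ≤ M₁) (h3 : ∀ z, ‖z - c‖ = r₃ → ‖g z‖ ≤ M₃)
    (hz1 : r₁ ≤ ‖z - c‖) (hz3 : ‖z - c‖ ≤ r₃) :
    ‖g z‖ ≤ M₁ ^ (1 - (Real.log ‖z - c‖ - Real.log r₁) / (Real.log r₃ - Real.log r₁)) *
      M₃ ^ ((Real.log ‖z - c‖ - Real.log r₁) / (Real.log r₃ - Real.log r₁)) := by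
  have hr₃ : 0 < r₃ := hr₁.trans h13
  have hz0 : 0 < ‖z - c‖ := hr₁.trans_le hz1
  have hzc : z - c ≠ 0 := norm_pos_iff.1 hz0
  have hmem (w : ℂ) (hw : w.re ≤ Real.log r₃) : c + exp w ∈ closedBall c r₃ := by
    simpa [norm_exp] using (Real.le_log_iff_exp_le hr₃).1 hw
  have hsub : closedBall c r₃ ⊆ ball c R := closedBall_subset_ball h3R
  have hdiff : DifferentiableOn ℂ (fun w ↦ g (c + exp w)) (re ⁻¹' Iic (Real.log r₃)) :=
    hg.comp (by fun_prop) fun w hw ↦ hsub (hmem w hw)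
  have hcl : closure (HadamardThreeLines.verticalStrip (Real.log r₁) (Real.log r₃)) ⊆
      re ⁻¹' Iic (Real.log r₃) :=
    closure_minimal (fun w hw ↦ hw.2.le) (isClosed_Iic.preimage continuous_re)
  have h := HadamardThreeLines.norm_le_interp_of_mem_verticalClosedStrip'
    (f := fun w ↦ g (c + exp w)) (z := log (z - c)) (a := M₁) (b := M₃)
    (Real.log_lt_log hr₁ h13) ?_ (hdiff.mono hcl).diffContOnCl ?_ ?_ ?_
  · simpa [exp_log hzc, log_re] using h
  · simp only [HadamardThreeLines.verticalClosedStrip, mem_preimage, log_re, mem_Icc]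
    exact ⟨Real.log_le_log hr₁ hz1, Real.log_le_log hz0 hz3⟩
  · obtain ⟨K, hK⟩ := ((isCompact_closedBall c r₃).image_of_continuousOn
      (hg.continuousOn.mono hsub)).isBounded.exists_norm_le
    refine ⟨K, ?_⟩
    rintro _ ⟨w, hw, rfl⟩
    exact hK _ ⟨_, hmem w hw.2, rfl⟩
  · intro w hw
    refine h1 _ ?_
    rw [add_sub_cancel_left, norm_exp, show w.re = _ from hw, Real.exp_log hr₁]
  · intro w hw
    refine h3 _ ?_
    rw [add_sub_cancel_left, norm_exp, show w.re = _ from hw, Real.exp_log hr₃]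

theorem exists_rpow_le_mul_add {θ η : ℝ} (hθ0 : 0 ≤ θ) (hθ : θ < 1) (hη : 0 < η) :
    ∃ D : ℝ, 0 ≤ D ∧ ∀ u : ℝ, 0 ≤ u → u ^ θ ≤ η * u + D := by
  set v := η ^ (-(1 - θ)⁻¹) with hv
  have hv0 : 0 < v := Real.rpow_pos_of_pos hη _
  have hvη : v ^ (θ - 1) = η := by
    rw [hv, ← Real.rpow_mul hη.le, show -(1 - θ)⁻¹ * (θ - 1) = 1 by
      have : 1 - θ ≠ 0 := by linarith
      field_simp; ring, Real.rpow_one]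
  refine ⟨v ^ θ, by positivity, fun u hu ↦ ?_⟩
  rcases le_total u v with h | h
  · have : u ^ θ ≤ v ^ θ := by gcongr
    have : 0 ≤ η * u := by positivity
    linarith
  · have hu0 : 0 < u := hv0.trans_le h
    have h1 : u ^ (θ - 1) ≤ η := hvη ▸ Real.rpow_le_rpow_of_nonpos hv0 h (by linarith)
    have h2 : u ^ θ = u ^ (θ - 1) * u := by
      rw [← Real.rpow_add_one hu0.ne', sub_add_cancel]
    have : 0 ≤ v ^ θ := by positivity
    rw [h2]
    nlinarith

theorem exists_norm_le_mul_add_of_three_circles {r₁ r₂ r₃ η : ℝ} (hr₁ : 0 < r₁) (h12 : r₁ < r₂)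
    (h23 : r₂ < r₃) (hη : 0 < η) :
    ∃ D : ℝ, 0 ≤ D ∧ ∀ (g : ℂ → ℂ) (c : ℂ) (R M₁ M₃ : ℝ), r₃ < R → 0 < M₁ → 0 ≤ M₃ →
      DifferentiableOn ℂ g (ball c R) → (∀ z, ‖z - c‖ ≤ r₁ → ‖g z‖ ≤ M₁) →
      (∀ z, ‖z - c‖ = r₃ → ‖g z‖ ≤ M₃) → ∀ z, ‖z - c‖ ≤ r₂ → ‖g z‖ ≤ η * M₃ + D * M₁ := by
  have hlog13 : 0 < Real.log r₃ - Real.log r₁ :=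
    sub_pos.2 (Real.log_lt_log hr₁ (h12.trans h23))
  set θ := (Real.log r₂ - Real.log r₁) / (Real.log r₃ - Real.log r₁) with hθ
  have hθ0 : 0 ≤ θ := div_nonneg (sub_nonneg.2 (Real.log_le_log hr₁ h12.le)) hlog13.le
  have hθ1 : θ < 1 := by
    rw [hθ, div_lt_one hlog13]
    linarith [Real.log_lt_log (hr₁.trans h12) h23]
  obtain ⟨D, hD0, hD⟩ := exists_rpow_le_mul_add hθ0 hθ1 hη
  refine ⟨η + D + 1, by positivity, fun g c R M₁ M₃ h3R hM₁ hM₃ hg h1 h3 z hz ↦ ?_⟩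
  rcases le_total ‖z - c‖ r₁ with hzr | hzr
  · have := h1 z hzr
    have h2 : 0 ≤ η * M₃ := by positivity
    have h4 : 0 ≤ (η + D) * M₁ := by positivity
    linarith
  · have hz0 : 0 < ‖z - c‖ := hr₁.trans_le hzr
    have h := norm_le_of_three_circles hr₁ (h12.trans h23) h3R hg (fun z hz ↦ h1 z hz.le)
      (M₃ := M₃ + M₁) (fun z hz ↦ (h3 z hz).trans (by linarith)) hzr (hz.trans h23.le)
    set φ := (Real.log ‖z - c‖ - Real.log r₁) / (Real.log r₃ - Real.log r₁)
    have hφθ : φ ≤ θ := by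
      have := Real.log_le_log hz0 hz
      exact div_le_div_of_nonneg_right (sub_le_sub_right this _) hlog13.le
    have h5 : M₁ ^ (1 - φ) * (M₃ + M₁) ^ φ = M₁ * ((M₃ + M₁) / M₁) ^ φ := by
      rw [Real.div_rpow (by positivity) hM₁.le, Real.rpow_sub hM₁, Real.rpow_one]
      ring
    have h6 : ((M₃ + M₁) / M₁) ^ φ ≤ ((M₃ + M₁) / M₁) ^ θ :=
      Real.rpow_le_rpow_of_exponent_le ((one_le_div hM₁).2 (by linarith)) hφθ
    calc ‖g z‖ ≤ M₁ * ((M₃ + M₁) / M₁) ^ φ := h.trans h5.le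
      _ ≤ M₁ * (η * ((M₃ + M₁) / M₁) + D) := by
        gcongr; exact h6.trans (hD _ (by positivity))
      _ = η * M₃ + (η + D) * M₁ := by field_simp; ring
      _ ≤ η * M₃ + (η + D + 1) * M₁ := by linarith

theorem norm_LSeries_le_of_re_le {f : ℕ → ℂ} {w s : ℂ} (hf : LSeriesSummable f w)
    (h : w.re ≤ s.re) : ‖LSeries f s‖ ≤ ∑' n, ‖LSeries.term f w n‖ :=
  tsum_of_norm_bounded hf.norm.hasSum fun n ↦ LSeries.norm_term_le_of_re_le_re f h n

theorem exists_norm_riemannZeta_le_and_norm_inv_le {b : ℝ} (hb : 1 < b) :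
    ∃ B : ℝ, 2 ≤ B ∧ ∀ s : ℂ, b ≤ s.re → ‖riemannZeta s‖ ≤ B ∧ ‖(riemannZeta s)⁻¹‖ ≤ B := by
  have h1 := LSeriesSummable_one_iff.2 (show 1 < (b : ℂ).re by simpa)
  have h2 := ArithmeticFunction.LSeriesSummable_moebius_iff.2 (show 1 < (b : ℂ).re by simpa)
  refine ⟨max 2 (max (∑' n, ‖LSeries.term 1 b n‖) 
    (∑' n, ‖LSeries.term (fun n ↦ ((ArithmeticFunction.moebius n : ℤ) : ℂ)) b n‖)),
    le_max_left _ _, fun s hs ↦ ⟨?_, ?_⟩⟩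
  · rw [← LSeries_one_eq_riemannZeta (hb.trans_le hs)]
    exact (norm_LSeries_le_of_re_le h1 (by simpa)).trans
      ((le_max_left _ _).trans (le_max_right _ _))
  · rw [inv_riemannZeta_eq_LSeries_moebius (hb.trans_le hs)]
    exact (norm_LSeries_le_of_re_le h2 (by simpa)).trans
      ((le_max_right _ _).trans (le_max_right _ _))

theorem exists_norm_inv_riemannZeta_le_of_three_le {a σ ε : ℝ} (ha : 1 / 2 ≤ a)
    (h0 : ∀ s : ℂ, a < s.re → riemannZeta s ≠ 0) (haσ : a < σ) (hσ : σ ≤ 1) (hε : 0 < ε) :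
    ∃ C : ℝ, 0 < C ∧ ∀ s : ℂ, σ ≤ s.re → s.re ≤ 2 → 3 ≤ |s.im| →
      ‖(riemannZeta s)⁻¹‖ ≤ C * |s.im| ^ ε := by
  obtain ⟨B, hB2, hB⟩ := exists_norm_riemannZeta_le_and_norm_inv_le (b := 11 / 10) (by norm_num)
  have hB0 : 0 < B := by linarith
  set R := 2 - a with hR
  set r₃ := 2 - (a + σ) / 2 with hr₃
  have hr₃R : 0 < R - r₃ := by rw [hR, hr₃]; linarith
  have hr₃0 : 0 < r₃ := by rw [hr₃]; linarith
  set K := 2 * r₃ / (R - r₃) with hK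
  have hK0 : 0 < K := by positivity
  obtain ⟨D, -, hD⟩ := exists_norm_le_mul_add_of_three_circles (r₁ := 1 / 2) (r₂ := 2 - σ)
    (r₃ := r₃) (η := ε / K) (by norm_num) (by linarith) (by rw [hr₃]; linarith) (by positivity)
  set M₁ := 2 * Real.log (B * B) * (1 / 2) / (9 / 10 - 1 / 2) with hM₁
  have hlogB : 0 < Real.log (B * B) := Real.log_pos (by nlinarith)
  have hM₁0 : 0 < M₁ := div_pos (by positivity) (by norm_num)
  refine ⟨B * Real.exp (D * M₁) * (9 * B) ^ ε, by positivity, fun s hs hs2 hst ↦ ?_⟩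
  set c : ℂ := ⟨2, s.im⟩ with hc
  have ht0 : 0 < |s.im| := by linarith
  have him (z : ℂ) (hz : z ∈ ball c R) : 1 ≤ ‖z - 1‖ ∧ ‖z‖ ≤ 3 * |s.im| ∧ a < z.re := by
    rw [mem_ball, dist_eq_norm] at hz
    have h1 := (abs_re_le_norm (z - c)).trans_lt hz
    have h2 := (abs_im_le_norm (z - c)).trans_lt hz
    have h3 := abs_im_le_norm (z - 1)
    have h4 := norm_le_abs_re_add_abs_im z
    simp only [hc, sub_re, sub_im, one_im, sub_zero] at h1 h2 h3
    have h5 := abs_sub_abs_le_abs_sub s.im z.im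
    have h6 := abs_sub_abs_le_abs_sub z.im s.im
    rw [abs_sub_comm] at h5
    rw [abs_lt] at h1
    have h7 : |z.re| ≤ 4 := abs_le.2 ⟨by linarith, by linarith⟩
    refine ⟨by linarith, ?_, by linarith⟩
    have : |z.re| ≤ 7 / 2 := abs_le.2 ⟨by linarith, by linarith⟩
    linarith
  have hd : DifferentiableOn ℂ riemannZeta (ball c R) := fun z hz ↦
    (differentiableAt_riemannZeta fun h1 ↦ by
      have := (him z hz).1; norm_num [h1] at this).differentiableWithinAt
  obtain ⟨g, hgd, hgc, hg⟩ := exists_eq_mul_exp_of_ne_zero hd fun z hz ↦ h0 z (him z hz).2.2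
  have hRB (z : ℂ) (hz : z ∈ ball c R) {A : ℝ} (hA : 0 < A) (hzA : ‖riemannZeta z‖ ≤ A) :
      (g z).re ≤ Real.log (A * B) := by
    rw [Real.le_log_iff_exp_le (by positivity), ← norm_exp]
    have h1 : exp (g z) = riemannZeta z * (riemannZeta c)⁻¹ := by
      have : riemannZeta c ≠ 0 := h0 c (by simp only [hc]; linarith)
      rw [hg z hz]; field_simp
    rw [h1, norm_mul]
    gcongr
    exact (hB c (by norm_num [hc])).2
  set L := Real.log (3 * (3 * |s.im|) * B) with hL
  have hL0 : 0 < L := Real.log_pos (by nlinarith)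
  have hsc : ‖s - c‖ ≤ 2 - σ := by
    have : s - c = ((s.re - 2 : ℝ) : ℂ) := by apply Complex.ext <;> simp [hc]
    rw [this, norm_real, Real.norm_eq_abs, abs_le]
    constructor <;> linarith
  have hsub : ball c (9 / 10) ⊆ ball c R := ball_subset_ball (by linarith)
  have hmain := hD g c R M₁ (2 * L * r₃ / (R - r₃)) (by linarith) hM₁0 (by positivity) hgd
    (fun z hz ↦ norm_le_of_re_le_of_ball hlogB (by norm_num) (hgd.mono hsub)
      (fun w hw ↦ hRB w (hsub hw) hB0 (hB w ?_).1) hgc hz)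
    (fun z hz ↦ norm_le_of_re_le_of_ball hL0 (by linarith) hgd
      (fun w hw ↦ hRB w hw (by positivity) ?_) hgc hz.le) s hsc
  · have hs' : s ∈ ball c R := by
      rw [mem_ball, dist_eq_norm]
      linarith
    have hηM : ε / K * (2 * L * r₃ / (R - r₃)) = L * ε := by
      rw [hK]; field_simp
    rw [hηM] at hmain
    rw [hg s hs', mul_inv, norm_mul, ← exp_neg, norm_exp]
    calc ‖(riemannZeta c)⁻¹‖ * Real.exp (-g s).re
        ≤ B * Real.exp (L * ε + D * M₁) := by
          gcongr
          · exact (hB c (by norm_num [hc])).2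
          · exact ((re_le_norm _).trans_eq (norm_neg _)).trans hmain
      _ = B * Real.exp (D * M₁) * (9 * B) ^ ε * |s.im| ^ ε := by
          rw [Real.exp_add, hL, ← Real.rpow_def_of_pos (by positivity), mul_assoc _ (_ ^ ε),
            ← Real.mul_rpow (by positivity) (by positivity)]
          ring_nf
  · rw [mem_ball, dist_eq_norm] at hw
    have h1 := (abs_re_le_norm (w - c)).trans_lt hw
    simp only [hc, sub_re, abs_lt] at h1
    linarith
  · obtain ⟨h1, h2, h3⟩ := him w hw
    exact (norm_riemannZeta_le (by linarith) h1).trans (by linarith)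

theorem riemannZeta₁_ne_zero {s : ℂ} (hs : riemannZeta s ≠ 0) : riemannZeta₁ s ≠ 0 := by
  rcases eq_or_ne s 1 with rfl | h1
  · simp
  · rw [riemannZeta_eq_inv_sub_mul h1] at hs
    exact right_ne_zero_of_mul hs

theorem exists_norm_mul_inv_riemannZeta₁_le {a σ ε : ℝ} (ha : 1 / 2 ≤ a)
    (h0 : ∀ s : ℂ, a < s.re → riemannZeta s ≠ 0) (haσ : a < σ) (hσ : σ ≤ 1) (hε : 0 < ε) :
    ∃ C : ℝ, 0 < C ∧ ∀ s : ℂ, σ ≤ s.re → s.re ≤ 2 →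
      ‖(s - 1) * (riemannZeta₁ s)⁻¹‖ ≤ C * (1 + |s.im|) ^ ε := by
  obtain ⟨C, hC0, hC⟩ := exists_norm_inv_riemannZeta_le_of_three_le ha h0 haσ hσ hε
  have hcont : ContinuousOn (fun s : ℂ ↦ (s - 1) * (riemannZeta₁ s)⁻¹)
      (Icc σ 2 ×ℂ Icc (-3) 3) := fun s hs ↦ by
    have h := riemannZeta₁_ne_zero (h0 s (haσ.trans_le hs.1.1))
    exact (ContinuousAt.mul (by fun_prop)
      (differentiable_riemannZeta₁.continuous.continuousAt.inv₀ h)).continuousWithinAt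
  obtain ⟨A, hA⟩ := (isCompact_Icc.reProdIm isCompact_Icc).exists_bound_of_continuousOn hcont
  refine ⟨C + |A|, by positivity, fun s hs hs2 ↦ ?_⟩
  have h1 : 1 ≤ (1 + |s.im|) ^ ε := Real.one_le_rpow (by linarith [abs_nonneg s.im]) hε.le
  rcases le_total 3 |s.im| with h3 | h3
  · have hs1 : s ≠ 1 := by rintro rfl; norm_num at h3
    have : (s - 1) * (riemannZeta₁ s)⁻¹ = (riemannZeta s)⁻¹ := by
      rw [riemannZeta_eq_inv_sub_mul hs1, mul_inv, inv_inv]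
    rw [this]
    calc _ ≤ C * |s.im| ^ ε := hC s hs hs2 h3
      _ ≤ (C + |A|) * (1 + |s.im|) ^ ε := by gcongr <;> linarith [abs_nonneg A]
  · calc _ ≤ A := hA s ⟨⟨hs, hs2⟩, abs_le.1 h3⟩
      _ ≤ (C + |A|) * 1 := by linarith [le_abs_self A]
      _ ≤ _ := by gcongr

theorem one_add_abs_im_le_mul_norm {s : ℂ} (hs : 1 / 2 ≤ s.re) : 1 + |s.im| ≤ 3 * ‖s‖ := by
  have h1 : ‖s‖ ^ 2 = s.re ^ 2 + s.im ^ 2 := by rw [Complex.sq_norm, normSq_apply]; ring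
  refine le_of_abs_le (abs_le_of_sq_le_sq ?_ (by positivity))
  nlinarith [sq_abs s.im, sq_nonneg (|s.im| - 1)]

theorem norm_le_norm_add_one {s : ℂ} (hs : 1 / 2 ≤ s.re) : ‖s‖ ≤ ‖s + 1‖ := by
  refine le_of_abs_le (abs_le_of_sq_le_sq ?_ (by positivity))
  simp only [Complex.sq_norm, normSq_apply, add_re, one_re, add_im, one_im]
  nlinarith

theorem norm_inv_mul_add_one_le {s : ℂ} (hs : 1 / 2 ≤ s.re) :
    ‖(s * (s + 1))⁻¹‖ ≤ 9 * (1 + |s.im|) ^ (-2 : ℝ) := by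
  have h1 := one_add_abs_im_le_mul_norm hs
  have h2 := norm_le_norm_add_one hs
  have h0 : 0 < 1 + |s.im| := by positivity
  rw [norm_inv, norm_mul, Real.rpow_neg h0.le, Real.rpow_two, ← div_eq_mul_inv,
    inv_le_comm₀ (by nlinarith) (by positivity), inv_div, div_le_iff₀ (by norm_num)]
  nlinarith

theorem integrable_inv_mul_add_one {σ : ℝ} (hσ : 1 / 2 ≤ σ) :
    Integrable fun y : ℝ ↦ (((σ : ℂ) + y * I) * ((σ : ℂ) + y * I + 1))⁻¹ := by
  have hre (y : ℝ) : ((σ : ℂ) + y * I).re = σ := by simp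
  refine ((integrable_one_add_norm (E := ℝ) (μ := volume) (r := 2) (by simp)).const_mul 9).mono'
    (Continuous.aestronglyMeasurable (Continuous.inv₀ (by fun_prop) fun y ↦ ?_))
    (.of_forall fun y ↦ ?_)
  · refine mul_ne_zero (fun h ↦ ?_) fun h ↦ ?_
    · have := congrArg re h; simp at this; linarith
    · have := congrArg re h; simp at this; linarith
  · simpa using norm_inv_mul_add_one_le (s := (σ : ℂ) + y * I) (by simpa using hσ)

theorem integral_cpow_neg_mul_inv_mul_add_one {σ x : ℝ} (hσ : 1 / 2 ≤ σ) (hx : 0 < x) :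
    ∫ y : ℝ, (x : ℂ) ^ (-((σ : ℂ) + y * I)) * (((σ : ℂ) + y * I) * ((σ : ℂ) + y * I + 1))⁻¹ =
      2 * Real.pi * (max (1 - x) 0 : ℝ) := by
  set f : ℝ → ℂ := fun u ↦ (Ioc (0 : ℝ) 1).indicator (fun _ ↦ (1 : ℂ)) u -
    (Ioc (0 : ℝ) 1).indicator (fun t : ℝ ↦ (t : ℂ) ^ (1 : ℂ)) u with hf
  have hfx (u : ℝ) (hu : 0 < u) : f u = (max (1 - u) 0 : ℝ) := by
    by_cases h1 : u ≤ 1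
    · have : u ∈ Ioc (0 : ℝ) 1 := ⟨hu, h1⟩
      simp [hf, this, max_eq_left (sub_nonneg.2 h1)]
    · have : u ∉ Ioc (0 : ℝ) 1 := fun h ↦ h1 h.2
      simp [hf, this, max_eq_right (sub_nonpos.2 (not_le.1 h1).le)]
  have hM (s : ℂ) (hs : 0 < s.re) : HasMellin f s (s * (s + 1))⁻¹ := by
    have h1 := hasMellin_one_Ioc hs
    have h2 := hasMellin_cpow_Ioc 1 (s := s) (by simp; linarith)
    have h3 := hasMellin_sub h1.1 h2.1
    refine ⟨h3.1, h3.2.trans ?_⟩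
    rw [h1.2, h2.2]
    have : s ≠ 0 := by rintro rfl; simp at hs
    have : s + 1 ≠ 0 := fun h ↦ by have := congrArg re h; simp at this; linarith
    field_simp
    ring
  have hMσ (y : ℝ) : mellin f (σ + y * I) = (((σ : ℂ) + y * I) * ((σ : ℂ) + y * I + 1))⁻¹ :=
    (hM _ (by simp; linarith)).2
  have hcont : ContinuousAt f x := by
    have : ContinuousAt (fun u : ℝ ↦ ((max (1 - u) 0 : ℝ) : ℂ)) x := by fun_prop
    exact this.congr (by filter_upwards [lt_mem_nhds hx] with u hu using (hfx u hu).symm)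
  have h := mellinInv_mellin_eq σ f hx (hM _ (by simp; linarith)).1
    (by simpa only [VerticalIntegrable, hMσ] using integrable_inv_mul_add_one hσ) hcont
  rw [hfx x hx, mellinInv] at h
  simp only [hMσ, smul_eq_mul] at h
  rw [← h, real_smul]
  have : (Real.pi : ℂ) ≠ 0 := by exact_mod_cast Real.pi_ne_zero
  push_cast
  rw [← mul_assoc, mul_one_div_cancel (mul_ne_zero two_ne_zero this), one_mul]

theorem continuous_LSeries_term (f : ℕ → ℂ) (n : ℕ) : Continuous fun s ↦ LSeries.term f s n := by
  rcases eq_or_ne n 0 with rfl | hn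
  · simpa using continuous_const
  · have hn' : (n : ℂ) ≠ 0 := by exact_mod_cast hn
    simp only [LSeries.term_of_ne_zero hn]
    exact continuous_const.div (continuous_id.const_cpow (.inl hn')) fun s ↦ by
      simp [cpow_eq_zero_iff, hn]

theorem integrable_LSeries_mul_cpow_mul_inv {f : ℕ → ℂ} {σ x : ℝ} (hσ : 1 / 2 ≤ σ)
    (hf : LSeriesSummable f σ) (hx : 0 < x) :
    Integrable fun y : ℝ ↦ LSeries f (σ + y * I) * ((x : ℂ) ^ ((σ : ℂ) + y * I) *
        (((σ : ℂ) + y * I) * ((σ : ℂ) + y * I + 1))⁻¹) := by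
  have hx0 : (x : ℂ) ≠ 0 := by exact_mod_cast hx.ne'
  have hb (y : ℝ) (n : ℕ) := LSeries.norm_term_le_of_re_le_re f (s := σ) (s' := σ + y * I)
    (by simp) n
  have hc : Continuous fun y : ℝ ↦ LSeries f (σ + y * I) :=
    continuous_tsum (fun n ↦ (continuous_LSeries_term f n).comp (by fun_prop)) hf.norm
      fun n y ↦ hb y n
  simp_rw [← mul_assoc (LSeries f _)]
  refine (integrable_inv_mul_add_one hσ).bdd_mul (c := (∑' n, ‖LSeries.term f σ n‖) * x ^ σ)
    (Continuous.aestronglyMeasurable ?_) (.of_forall fun y ↦ ?_)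
  · exact hc.mul (Continuous.const_cpow (by fun_prop) (.inl hx0))
  · have hre : ((σ : ℂ) + y * I).re = σ := by simp
    rw [norm_mul, norm_cpow_eq_rpow_re_of_pos hx, hre]
    gcongr
    exact tsum_of_norm_bounded hf.norm.hasSum (hb y)

theorem hasSum_mul_max_one_sub_div {f : ℕ → ℂ} {σ x : ℝ} (hσ : 1 / 2 ≤ σ)
    (hf : LSeriesSummable f σ) (hf0 : f 0 = 0) (hx : 0 < x) :
    HasSum (fun n ↦ 2 * Real.pi * (f n * (max (1 - n / x) 0 : ℝ)))
      (∫ y : ℝ, LSeries f (σ + y * I) * ((x : ℂ) ^ ((σ : ℂ) + y * I) *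
        (((σ : ℂ) + y * I) * ((σ : ℂ) + y * I + 1))⁻¹)) := by
  have hx0 : (x : ℂ) ≠ 0 := by exact_mod_cast hx.ne'
  set F : ℕ → ℝ → ℂ := fun n y ↦ LSeries.term f (σ + y * I) n * ((x : ℂ) ^ ((σ : ℂ) + y * I) *
        (((σ : ℂ) + y * I) * ((σ : ℂ) + y * I + 1))⁻¹) with hF
  have hF0 (y : ℝ) : F 0 y = 0 := by simp [hF]
  have hFn (n : ℕ) (hn : n ≠ 0) (y : ℝ) : F n y = f n *
      ((((n / x : ℝ) : ℂ) ^ (-((σ : ℂ) + y * I))) *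
        (((σ : ℂ) + y * I) * ((σ : ℂ) + y * I + 1))⁻¹) := by
    have h1 : ((n / x : ℝ) : ℂ) ^ (-((σ : ℂ) + y * I)) =
        (x : ℂ) ^ ((σ : ℂ) + y * I) / (n : ℂ) ^ ((σ : ℂ) + y * I) := by
      have harg : arg (x : ℂ) ≠ Real.pi := by
        rw [arg_ofReal_of_nonneg hx.le]
        exact Real.pi_pos.ne
      rw [div_eq_mul_inv (n : ℝ), ofReal_mul,
        mul_cpow_ofReal_nonneg (by positivity) (by positivity),
        ofReal_inv, cpow_neg, cpow_neg, inv_cpow _ _ harg,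
        inv_inv, ofReal_natCast]
      ring
    rw [h1, hF]
    simp only [LSeries.term_of_ne_zero hn]
    ring
  have hnorm (n : ℕ) (y : ℝ) : ‖F n y‖ = ‖LSeries.term f σ n‖ * x ^ σ *
      ‖(((σ : ℂ) + y * I) * ((σ : ℂ) + y * I + 1))⁻¹‖ := by
    rw [hF]
    simp only [norm_mul, LSeries.norm_term_eq, norm_cpow_eq_rpow_re_of_pos hx]
    simp [mul_assoc]
  have hint (n : ℕ) : Integrable (F n) := by
    refine (integrable_inv_mul_add_one hσ).norm.const_mul (‖LSeries.term f σ n‖ * x ^ σ) |>.mono'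
      ?_ (.of_forall fun y ↦ (hnorm n y).le)
    refine AEStronglyMeasurable.mul ?_ (AEStronglyMeasurable.mul ?_
      (integrable_inv_mul_add_one hσ).aestronglyMeasurable)
    · exact ((continuous_LSeries_term f n).comp (by fun_prop)).aestronglyMeasurable
    · exact (Continuous.const_cpow (by fun_prop) (.inl hx0)).aestronglyMeasurable
  have h := hasSum_integral_of_summable_integral_norm hint (by
    simp only [hnorm, integral_const_mul]
    exact (hf.norm.mul_right _).mul_right _)
  have hS (y : ℝ) : LSeries f (σ + y * I) * ((x : ℂ) ^ ((σ : ℂ) + y * I) *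
      (((σ : ℂ) + y * I) * ((σ : ℂ) + y * I + 1))⁻¹) = ∑' n, F n y := tsum_mul_right.symm
  have hT (n : ℕ) : 2 * Real.pi * (f n * (max (1 - n / x) 0 : ℝ)) = ∫ y, F n y := by
    rcases eq_or_ne n 0 with rfl | hn
    · simp [hF0, hf0]
    · simp only [hFn n hn, integral_const_mul]
      rw [integral_cpow_neg_mul_inv_mul_add_one hσ (by positivity)]
      ring
  simpa only [hS, hT] using h

theorem two_pi_mul_sum_eq_integral {f : ℕ → ℂ} {σ : ℝ} (hσ : 1 / 2 ≤ σ)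
    (hf : LSeriesSummable f σ) (hf0 : f 0 = 0) {N : ℕ} (hN : 0 < N) :
    2 * Real.pi * ∑ n ∈ Finset.Icc 1 N, f n = ∫ y : ℝ, LSeries f (σ + y * I) *
      ((((N + 1 : ℝ) : ℂ) ^ ((σ : ℂ) + y * I + 1) - ((N : ℝ) : ℂ) ^ ((σ : ℂ) + y * I + 1)) *
        (((σ : ℂ) + y * I) * ((σ : ℂ) + y * I + 1))⁻¹) := by
  have hN0 : 0 < (N : ℝ) := by exact_mod_cast hN
  have hN1 : 0 < (N + 1 : ℝ) := by positivity
  have h := ((hasSum_mul_max_one_sub_div hσ hf hf0 hN1).mul_left ((N + 1 : ℝ) : ℂ)).sub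
    ((hasSum_mul_max_one_sub_div hσ hf hf0 hN0).mul_left ((N : ℝ) : ℂ))
  rw [← integral_const_mul, ← integral_const_mul, ← integral_sub
    ((integrable_LSeries_mul_cpow_mul_inv hσ hf hN1).const_mul _)
    ((integrable_LSeries_mul_cpow_mul_inv hσ hf hN0).const_mul _)] at h
  have hterm (n : ℕ) :
      ((N + 1 : ℝ) : ℂ) * (2 * Real.pi * (f n * (max (1 - n / (N + 1 : ℝ)) 0 : ℝ))) -
      ((N : ℝ) : ℂ) * (2 * Real.pi * (f n * (max (1 - n / (N : ℝ)) 0 : ℝ))) =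
      if n ∈ Finset.Icc 1 N then 2 * Real.pi * f n else 0 := by
    have hmax {X : ℝ} (hX : 0 < X) : X * max (1 - n / X) 0 = max (X - n) 0 := by
      rw [mul_max_of_nonneg _ _ hX.le, mul_zero, mul_sub, mul_one, mul_div_cancel₀ _ hX.ne']
    have hcalc :
        ((N + 1 : ℝ) : ℂ) * (2 * Real.pi * (f n * (max (1 - n / (N + 1 : ℝ)) 0 : ℝ))) -
        ((N : ℝ) : ℂ) * (2 * Real.pi * (f n * (max (1 - n / (N : ℝ)) 0 : ℝ))) =
        2 * Real.pi * f n * ((max ((N + 1 : ℝ) - n) 0 - max ((N : ℝ) - n) 0 : ℝ) : ℂ) := by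
      rw [← hmax hN1, ← hmax hN0]
      push_cast
      ring
    rw [hcalc]
    rcases eq_or_ne n 0 with rfl | hn
    · simp [hf0]
    rcases le_or_gt n N with hnN | hnN
    · have h1 : (n : ℝ) ≤ N := by exact_mod_cast hnN
      rw [if_pos (Finset.mem_Icc.2 ⟨Nat.one_le_iff_ne_zero.2 hn, hnN⟩),
        max_eq_left (by linarith), max_eq_left (by linarith)]
      push_cast
      ring
    · have h1 : (N : ℝ) + 1 ≤ n := by exact_mod_cast hnN
      rw [if_neg (fun h ↦ by have := (Finset.mem_Icc.1 h).2; omega),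
        max_eq_right (by linarith), max_eq_right (by linarith)]
      simp
  simp only [hterm] at h
  have h2 := h.unique (hasSum_sum_of_ne_finset_zero (s := Finset.Icc 1 N) fun n hn ↦ if_neg hn)
  rw [Finset.mul_sum, ← Finset.sum_congr rfl fun n hn ↦ if_pos hn, ← h2]
  congr 1
  ext y
  have hp {X : ℝ} (hX : 0 < X) :
      (X : ℂ) ^ ((σ : ℂ) + y * I + 1) = X * (X : ℂ) ^ ((σ : ℂ) + y * I) := by
    rw [cpow_add _ _ (by exact_mod_cast hX.ne'), cpow_one, mul_comm]
  rw [hp hN0, hp hN1]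
  ring

theorem integrable_vertical_of_norm_le {f : ℂ → ℂ} {a C p : ℝ} (hp : 1 < p)
    (hf : ∀ s : ℂ, s.re = a → ContinuousAt f s)
    (hC : ∀ s : ℂ, s.re = a → ‖f s‖ ≤ C * (1 + |s.im|) ^ (-p)) :
    Integrable fun y : ℝ ↦ f (a + y * I) := by
  refine ((integrable_one_add_norm (E := ℝ) (μ := volume) (r := p) (by simpa)).const_mul C).mono'
    (Continuous.aestronglyMeasurable ?_) (.of_forall fun y ↦ ?_)
  · exact continuous_iff_continuousAt.2 fun y ↦
      ContinuousAt.comp (f := fun y : ℝ ↦ (a : ℂ) + y * I) (hf _ (by simp)) (by fun_prop)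
  · simpa using hC (a + y * I) (by simp)

theorem tendsto_intervalIntegral_horizontal {f : ℂ → ℂ} {a b C p : ℝ} (hab : a ≤ b) (hp : 0 < p)
    (hC : ∀ s : ℂ, a ≤ s.re → s.re ≤ b → ‖f s‖ ≤ C * (1 + |s.im|) ^ (-p))
    {T : ℝ → ℝ} (hT : Tendsto (fun t ↦ |T t|) atTop atTop) :
    Tendsto (fun t ↦ ∫ x : ℝ in a..b, f (x + T t * I)) atTop (𝓝 0) := by
  have h1 : Tendsto (fun t ↦ C * (1 + |T t|) ^ (-p) * |b - a|) atTop (𝓝 0) := by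
    simpa using (((tendsto_rpow_neg_atTop hp).comp
      (tendsto_atTop_add_const_left _ 1 hT)).const_mul C).mul_const |b - a|
  refine squeeze_zero_norm (fun t ↦ ?_) h1
  refine intervalIntegral.norm_integral_le_of_norm_le_const fun x hx ↦ ?_
  rw [uIoc_of_le hab] at hx
  simpa using hC (x + T t * I) (by simpa using hx.1.le) (by simpa using hx.2)

theorem integral_vertical_eq_of_norm_le {f : ℂ → ℂ} {a b C p : ℝ} (hab : a ≤ b) (hp : 1 < p)
    (hf : ∀ s : ℂ, a ≤ s.re → s.re ≤ b → DifferentiableAt ℂ f s)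
    (hC : ∀ s : ℂ, a ≤ s.re → s.re ≤ b → ‖f s‖ ≤ C * (1 + |s.im|) ^ (-p)) :
    ∫ y : ℝ, f (a + y * I) = ∫ y : ℝ, f (b + y * I) := by
  have hv (c : ℝ) (hac : a ≤ c) (hcb : c ≤ b) :
      Tendsto (fun T : ℝ ↦ ∫ y : ℝ in -T..T, f (c + y * I)) atTop
        (𝓝 (∫ y : ℝ, f (c + y * I))) :=
    intervalIntegral_tendsto_integral (integrable_vertical_of_norm_le hp
      (fun s hs ↦ (hf s (hs ▸ hac) (hs ▸ hcb)).continuousAt)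
      fun s hs ↦ hC s (hs ▸ hac) (hs ▸ hcb)) tendsto_neg_atTop_atBot tendsto_id
  have h1 := tendsto_intervalIntegral_horizontal hab (one_pos.trans hp) hC (T := fun t ↦ -t)
    (by simpa using tendsto_abs_atTop_atTop)
  have h2 := tendsto_intervalIntegral_horizontal hab (one_pos.trans hp) hC (T := fun t ↦ t)
    tendsto_abs_atTop_atTop
  have h3 := ((h1.sub h2).add ((hv b hab le_rfl).const_smul I)).sub
    ((hv a le_rfl hab).const_smul I)
  have h4 (T : ℝ) := integral_boundary_rect_eq_zero_of_differentiableOn f ⟨a, -T⟩ ⟨b, T⟩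
    fun s hs ↦ by
      have h5 : s.re ∈ Icc a b := by simpa [uIcc_of_le hab] using hs.1
      exact (hf s h5.1 h5.2).differentiableWithinAt
  have h5 := tendsto_nhds_unique h3 (tendsto_const_nhds.congr fun T ↦ (h4 T).symm)
  rw [sub_zero, zero_add, ← smul_sub, smul_eq_zero] at h5
  exact (sub_eq_zero.1 (h5.resolve_left I_ne_zero)).symm

theorem norm_cpow_add_one_sub_cpow_le_mul {y : ℝ} (hy : 0 < y) {s : ℂ} (hs : 0 ≤ s.re) :
    ‖((y + 1 : ℝ) : ℂ) ^ (s + 1) - (y : ℂ) ^ (s + 1)‖ ≤ ‖s + 1‖ * (y + 1) ^ s.re := by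
  have hd (t : ℝ) (ht : t ∈ Icc y (y + 1)) : HasDerivWithinAt (fun t : ℝ ↦ (t : ℂ) ^ (s + 1))
      ((s + 1) * (t : ℂ) ^ s) (Icc y (y + 1)) t := by
    have ht0 : 0 < t := hy.trans_le ht.1
    have h := (hasDerivAt_id (t : ℂ)).cpow_const (c := s + 1) (.inl (by simpa))
    simpa using h.comp_ofReal.hasDerivWithinAt
  have h := (convex_Icc y (y + 1)).norm_image_sub_le_of_norm_hasDerivWithin_le
    (C := ‖s + 1‖ * (y + 1) ^ s.re) hd (fun t ht ↦ by
      have ht0 : 0 < t := hy.trans_le ht.1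
      rw [norm_mul, norm_cpow_eq_rpow_re_of_pos ht0]
      gcongr
      exact ht.2) (left_mem_Icc.2 (by linarith)) (right_mem_Icc.2 (by linarith))
  simpa using h

theorem norm_cpow_add_one_sub_cpow_le_two_mul {y : ℝ} (hy : 0 < y) {s : ℂ} (hs : 0 ≤ s.re) :
    ‖((y + 1 : ℝ) : ℂ) ^ (s + 1) - (y : ℂ) ^ (s + 1)‖ ≤ 2 * (y + 1) ^ (s.re + 1) := by
  have hy1 : 0 < y + 1 := by linarith
  refine (norm_sub_le _ _).trans ?_
  rw [norm_cpow_eq_rpow_re_of_pos hy1, norm_cpow_eq_rpow_re_of_pos hy, add_re, one_re, two_mul]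
  gcongr
  linarith

theorem norm_cpow_add_one_sub_cpow_le {y δ : ℝ} (hy : 0 < y) {s : ℂ} (hs : 0 ≤ s.re)
    (hδ0 : 0 ≤ δ) (hδ1 : δ ≤ 1) :
    ‖((y + 1 : ℝ) : ℂ) ^ (s + 1) - (y : ℂ) ^ (s + 1)‖ ≤
      2 * (y + 1) ^ (s.re + δ) * ‖s + 1‖ ^ (1 - δ) := by
  set A := ‖((y + 1 : ℝ) : ℂ) ^ (s + 1) - (y : ℂ) ^ (s + 1)‖ with hA
  have hA0 : 0 ≤ A := norm_nonneg _
  have hy1 : 0 < y + 1 := by linarith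
  calc A = A ^ δ * A ^ (1 - δ) := by
        rw [← Real.rpow_add_of_nonneg hA0 hδ0 (by linarith)]; simp
    _ ≤ (2 * (y + 1) ^ (s.re + 1)) ^ δ * (‖s + 1‖ * (y + 1) ^ s.re) ^ (1 - δ) := by
        have := norm_cpow_add_one_sub_cpow_le_two_mul hy hs
        have := norm_cpow_add_one_sub_cpow_le_mul hy hs
        have : 0 ≤ 1 - δ := by linarith
        gcongr
    _ = 2 ^ δ * (y + 1) ^ (s.re + δ) * ‖s + 1‖ ^ (1 - δ) := by
        rw [Real.mul_rpow (by positivity) (by positivity), Real.mul_rpow (by positivity)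
          (by positivity), ← Real.rpow_mul hy1.le, ← Real.rpow_mul hy1.le,
          show s.re + δ = (s.re + 1) * δ + s.re * (1 - δ) by ring, Real.rpow_add hy1]
        ring
    _ ≤ 2 * (y + 1) ^ (s.re + δ) * ‖s + 1‖ ^ (1 - δ) := by
        gcongr
        simpa using Real.rpow_le_rpow_of_exponent_le (one_le_two (α := ℝ)) hδ1

theorem norm_cpow_sub_cpow_mul_inv_le {y δ : ℝ} (hy : 0 < y) {s : ℂ} (hs : 1 / 2 ≤ s.re)
    (hδ0 : 0 ≤ δ) (hδ1 : δ ≤ 1) :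
    ‖(((y + 1 : ℝ) : ℂ) ^ (s + 1) - (y : ℂ) ^ (s + 1)) * (s * (s + 1))⁻¹‖ ≤
      18 * (y + 1) ^ (s.re + δ) * (1 + |s.im|) ^ (-(1 + δ)) := by
  have h1 := one_add_abs_im_le_mul_norm hs
  have h2 := norm_le_norm_add_one hs
  have h0 : 0 < 1 + |s.im| := by positivity
  have hs0 : 0 < ‖s‖ := by linarith
  have hs1 : 0 < ‖s + 1‖ := by linarith
  have hy1 : 0 < y + 1 := by linarith
  rw [norm_mul, norm_inv, norm_mul]
  calc _ ≤ 2 * (y + 1) ^ (s.re + δ) * ‖s + 1‖ ^ (1 - δ) * (‖s‖ * ‖s + 1‖)⁻¹ := by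
        gcongr
        exact norm_cpow_add_one_sub_cpow_le hy (by linarith) hδ0 hδ1
    _ = 2 * (y + 1) ^ (s.re + δ) * (‖s‖⁻¹ * ‖s + 1‖ ^ (-δ)) := by
        rw [sub_eq_add_neg, Real.rpow_add hs1, Real.rpow_one]
        field_simp
    _ ≤ 2 * (y + 1) ^ (s.re + δ) * (‖s‖⁻¹ * ‖s‖ ^ (-δ)) := by
        gcongr 2 * (y + 1) ^ (s.re + δ) * (‖s‖⁻¹ * ?_)
        exact Real.rpow_le_rpow_of_nonpos hs0 h2 (by linarith)
    _ = 2 * (y + 1) ^ (s.re + δ) * ‖s‖ ^ (-(1 + δ)) := by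
        rw [neg_add, Real.rpow_add hs0, Real.rpow_neg_one]
    _ ≤ 2 * (y + 1) ^ (s.re + δ) * ((1 + |s.im|) / 3) ^ (-(1 + δ)) := by
        gcongr 2 * (y + 1) ^ (s.re + δ) * ?_
        exact Real.rpow_le_rpow_of_nonpos (by positivity) (by linarith) (by linarith)
    _ = 2 * (y + 1) ^ (s.re + δ) * (3 ^ (1 + δ) * (1 + |s.im|) ^ (-(1 + δ))) := by
        rw [Real.div_rpow h0.le (by norm_num), Real.rpow_neg (x := 3) (by norm_num), div_inv_eq_mul,
          mul_comm (_ ^ (-(1 + δ)))]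
    _ ≤ 2 * (y + 1) ^ (s.re + δ) * (9 * (1 + |s.im|) ^ (-(1 + δ))) := by
        gcongr
        calc (3 : ℝ) ^ (1 + δ) ≤ 3 ^ (2 : ℝ) :=
              Real.rpow_le_rpow_of_exponent_le (by norm_num) (by linarith)
          _ = 9 := by norm_num
    _ = _ := by ring

theorem exists_abs_sum_moebius_le {a ε : ℝ} (ha : 1 / 2 ≤ a) (ha1 : a < 1)
    (h0 : ∀ s : ℂ, a < s.re → riemannZeta s ≠ 0) (hε : 0 < ε) (hεa : ε ≤ 1 - a) :
    ∃ C : ℝ, 0 < C ∧ ∀ N : ℕ, 0 < N →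
      |∑ n ∈ Finset.Icc 1 N, ((ArithmeticFunction.moebius n : ℤ) : ℝ)| ≤
        C * (N + 1) ^ (a + ε) := by
  set σ := a + ε / 2 with hσ
  obtain ⟨C, hC0, hC⟩ := exists_norm_mul_inv_riemannZeta₁_le (σ := σ) (ε := ε / 4) ha h0
    (by linarith) (by linarith) (by linarith)
  set p := 1 + ε / 4 with hp
  set J := ∫ y : ℝ, (1 + ‖y‖) ^ (-p)
  have hJ0 : 0 ≤ J := integral_nonneg fun y ↦ by positivity
  refine ⟨18 * C * (J + 1), by positivity, fun N hN ↦ ?_⟩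
  have hN0 : 0 < (N : ℝ) := by exact_mod_cast hN
  have hN1 : 1 ≤ (N + 1 : ℝ) := by linarith
  set K : ℂ → ℂ := fun s ↦ (s - 1) * (riemannZeta₁ s)⁻¹ *
    ((((N + 1 : ℝ) : ℂ) ^ (s + 1) - ((N : ℝ) : ℂ) ^ (s + 1)) * (s * (s + 1))⁻¹) with hK
  have hKn (s : ℂ) (h1 : σ ≤ s.re) (h2 : s.re ≤ 2) :
      ‖K s‖ ≤ 18 * C * (N + 1) ^ (s.re + ε / 2) * (1 + |s.im|) ^ (-p) := by
    rw [hK, norm_mul]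
    calc _ ≤ C * (1 + |s.im|) ^ (ε / 4) *
          (18 * (N + 1) ^ (s.re + ε / 2) * (1 + |s.im|) ^ (-(1 + ε / 2))) := by
          gcongr
          · exact hC s h1 h2
          · exact norm_cpow_sub_cpow_mul_inv_le hN0 (by linarith) (by linarith) (by linarith)
      _ = 18 * C * (N + 1) ^ (s.re + ε / 2) *
          ((1 + |s.im|) ^ (ε / 4) * (1 + |s.im|) ^ (-(1 + ε / 2))) := by ring
      _ = _ := by
          rw [← Real.rpow_add (by positivity)]
          congr 2
          rw [hp]; ring
  have hKd (s : ℂ) (h1 : σ ≤ s.re) (_ : s.re ≤ 2) : DifferentiableAt ℂ K s := by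
    have hs0 : s ≠ 0 := by rintro rfl; simp at h1; linarith
    have hs1 : s + 1 ≠ 0 := fun h ↦ by have := congrArg re h; simp at this; linarith
    have hζ := riemannZeta₁_ne_zero (h0 s (by linarith))
    have hN0' : ((N : ℝ) : ℂ) ≠ 0 := by exact_mod_cast hN0.ne'
    have hN1' : ((N + 1 : ℝ) : ℂ) ≠ 0 := by exact_mod_cast (one_pos.trans_le hN1).ne'
    refine (DifferentiableAt.mul (by fun_prop) ((differentiable_riemannZeta₁ s).inv hζ)).mul
      (DifferentiableAt.mul (.sub (.const_cpow (by fun_prop) (.inl hN1'))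
        (.const_cpow (by fun_prop) (.inl hN0'))) (.inv (by fun_prop) (mul_ne_zero hs0 hs1)))
  have hshift : ∫ y : ℝ, K ((σ : ℝ) + y * I) = ∫ y : ℝ, K ((2 : ℝ) + y * I) :=
    integral_vertical_eq_of_norm_le (C := 18 * C * (N + 1) ^ (2 + ε / 2)) (p := p)
      (by linarith) (by linarith) hKd fun s h1 h2 ↦ (hKn s h1 h2).trans (by gcongr)
  have hsum := two_pi_mul_sum_eq_integral (σ := 2)
    (f := fun n ↦ ((ArithmeticFunction.moebius n : ℤ) : ℂ)) (by norm_num)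
    (ArithmeticFunction.LSeriesSummable_moebius_iff.2 (by simp)) (by simp) hN
  have hL (y : ℝ) : LSeries (fun n ↦ ((ArithmeticFunction.moebius n : ℤ) : ℂ)) ((2 : ℝ) + y * I) =
      ((2 : ℝ) + y * I - 1) * (riemannZeta₁ ((2 : ℝ) + y * I))⁻¹ := by
    have hre : 1 < (((2 : ℝ) : ℂ) + y * I).re := by simp
    rw [← inv_riemannZeta_eq_LSeries_moebius hre, riemannZeta_eq_inv_sub_mul
      (fun h ↦ by rw [h] at hre; simp at hre), mul_inv, inv_inv]
  simp only [hL] at hsum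
  have hbound : ‖∫ y : ℝ, K ((σ : ℝ) + y * I)‖ ≤ 18 * C * (N + 1) ^ (a + ε) * J := by
    rw [← integral_const_mul]
    refine norm_integral_le_of_norm_le
      ((integrable_one_add_norm (by simp [hp]; linarith)).const_mul _)
      (.of_forall fun y ↦ ?_)
    have := hKn (σ + y * I) (by simp) (by simp; linarith)
    have hre : ((σ : ℂ) + y * I).re + ε / 2 = a + ε := by simp [hσ]; ring
    rw [hre] at this
    simpa using this
  rw [hshift, ← hsum, norm_mul] at hbound
  have hcast : |∑ n ∈ Finset.Icc 1 N, ((ArithmeticFunction.moebius n : ℤ) : ℝ)| =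
      ‖∑ n ∈ Finset.Icc 1 N, ((ArithmeticFunction.moebius n : ℤ) : ℂ)‖ := by
    rw [← Real.norm_eq_abs, ← norm_real]
    push_cast
    rfl
  rw [hcast]
  have hpi : 1 ≤ ‖2 * (Real.pi : ℂ)‖ := by
    simp [abs_of_pos Real.pi_pos]
    linarith [Real.pi_gt_three]
  calc _ ≤ ‖2 * (Real.pi : ℂ)‖ *
        ‖∑ n ∈ Finset.Icc 1 N, ((ArithmeticFunction.moebius n : ℤ) : ℂ)‖ :=
        le_mul_of_one_le_left (norm_nonneg _) hpi
    _ ≤ 18 * C * (N + 1) ^ (a + ε) * J := hbound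
    _ ≤ 18 * C * (N + 1) ^ (a + ε) * (J + 1) := by gcongr; linarith
    _ = _ := by ring

theorem sum_moebius_le_of_qrh {r : ℝ} (hr : 0 ≤ r) (hr1 : r < 1 / 2) (h : QRH r) {ε : ℝ}
    (hε : 0 < ε) : ∃ C : ℝ, 0 < C ∧ ∀ x : ℝ, 1 ≤ x →
      |∑ n ∈ Finset.Icc 1 ⌊x⌋₊, ((ArithmeticFunction.moebius n : ℤ) : ℝ)|
        ≤ C * x ^ (1 / 2 + r + ε) := by
  have h0 (s : ℂ) (hs : 1 / 2 + r < s.re) : riemannZeta s ≠ 0 := fun hz ↦ by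
    refine (h s hz ?_).2.not_gt hs
    rintro ⟨n, rfl⟩
    norm_num at hs
    linarith [n.cast_nonneg (α := ℝ)]
  set δ := min ε (1 - (1 / 2 + r)) with hδ
  have hδ0 : 0 < δ := lt_min hε (by linarith)
  obtain ⟨C, hC0, hC⟩ := exists_abs_sum_moebius_le (by linarith) (by linarith) h0 hδ0
    (min_le_right _ _)
  refine ⟨C * 2 ^ (1 / 2 + r + δ), by positivity, fun x hx ↦ ?_⟩
  calc _ ≤ C * (⌊x⌋₊ + 1) ^ (1 / 2 + r + δ) := hC _ (Nat.floor_pos.2 hx)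
    _ ≤ C * (2 * x) ^ (1 / 2 + r + δ) := by
      gcongr
      linarith [Nat.floor_le (zero_le_one.trans hx)]
    _ = C * 2 ^ (1 / 2 + r + δ) * x ^ (1 / 2 + r + δ) := by
      rw [Real.mul_rpow (by norm_num) (by linarith), mul_assoc]
    _ ≤ _ := by
      gcongr
      exact min_le_left _ _

end

theorem stmt6 : QRH (1/10) ↔
    ∀ ε : ℝ, 0 < ε → ∃ C : ℝ, 0 < C ∧ ∀ x : ℝ, 1 ≤ x →
      |∑ n ∈ Finset.Icc 1 ⌊x⌋₊, ((ArithmeticFunction.moebius n : ℤ) : ℝ)|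
        ≤ C * x ^ (3/5 + ε) := by
  have h35 : (3 / 5 : ℝ) = 1 / 2 + 1 / 10 := by norm_num
  rw [h35]
  exact ⟨fun h ε hε ↦ sum_moebius_le_of_qrh (by norm_num) (by norm_num) h hε,
    qrh_of_sum_moebius_le (by norm_num)⟩
end

section
/- Let ε ∈ (0, 1/1000). There is a constant C_ε > 0 such that for all x ≥ 2, all primes q with q ≤ x^{1−ε}, all real z with 1 ≤ z ≤ 2x, and every interval I ⊆ [x, 3x], one has (1/φ(q)) · ∑_{χ mod q, χ ≠ χ₀} | ∑_{(n,c): c⁶ ≤ z, nc⁶ ∈ I} μ(c)·χ(n)·χ(c)⁶·f(n) |² ≤ C_ε · ( z^{1/3} + |I|^{1/6}·q^{5/6} ) · (log x)⁶, where |I| denotes the length of I. -/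
open MeasureTheory
open scoped Classical

/-- Real value of the Riemann zeta function at a real point. -/
noncomputable def zr (s : ℝ) : ℝ := (riemannZeta (s : ℂ)).re

/-- The smooth approximant `f(u) = ζ(3/2)/(2 u^{1/2}) + ζ(2/3)/(3 u^{2/3})`. -/
noncomputable def fm (u : ℝ) : ℝ :=
  zr (3/2) / (2 * u ^ ((1:ℝ)/2)) + zr (2/3) / (3 * u ^ ((2:ℝ)/3))

/-- `W(y) = ∫_1^2 f(u) e^{-2π i u y} du`. -/
noncomputable def Wf (y : ℝ) : ℂ :=
  ∫ u in (1:ℝ)..2, (fm u : ℂ) * Complex.exp (((-2 * Real.pi * u * y : ℝ) : ℂ) * Complex.I)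

/-- The constant `C = (ζ(11/6)/2) ∏_p (1 - p⁻² + 2p⁻⁶ + 2p⁻⁷) ∫_0^∞ |W(y)|² y^{5/6} dy`. -/
noncomputable def Cmain : ℝ :=
  (zr (11/6) / 2) *
    (∏' p : Nat.Primes, (1 - 1/((p:ℕ):ℝ)^2 + 2/((p:ℕ):ℝ)^6 + 2/((p:ℕ):ℝ)^7)) *
    ∫ y in Set.Ioi (0:ℝ), ‖Wf y‖^2 * y ^ ((5:ℝ)/6)

/-- Parseval's identity for Dirichlet characters, as an inequality for the sum over all classes. -/
lemma sum_norm_sq_dirichletCharacter_le {q : ℕ} [NeZero q] (t : ZMod q → ℝ) :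
    ∑ χ : DirichletCharacter ℂ q, ‖∑ r, χ r * (t r : ℂ)‖ ^ 2 ≤ q.totient * ∑ r, t r ^ 2 := by
  have key : ∑ χ : DirichletCharacter ℂ q, ((‖∑ r, χ r * (t r : ℂ)‖ ^ 2 : ℝ) : ℂ) =
      ∑ r : ZMod q, if IsUnit r then (q.totient : ℂ) * (t r : ℂ) ^ 2 else 0 := by
    have h1 : ∀ χ : DirichletCharacter ℂ q, ((‖∑ r, χ r * (t r : ℂ)‖ ^ 2 : ℝ) : ℂ) =
        ∑ r, ∑ s, (star (χ r) * χ s) * ((t r : ℂ) * (t s : ℂ)) := by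
      intro χ
      rw [Complex.ofReal_pow, ← Complex.conj_mul', map_sum, Finset.sum_mul_sum]
      refine Finset.sum_congr rfl fun r _ => Finset.sum_congr rfl fun s _ => ?_
      rw [map_mul, Complex.conj_ofReal, starRingEnd_apply]
      ring
    simp_rw [h1]
    rw [Finset.sum_comm]
    refine Finset.sum_congr rfl fun r _ => ?_
    rw [Finset.sum_comm]
    split_ifs with hr
    · have h2 : ∀ s : ZMod q, ∑ χ : DirichletCharacter ℂ q,
          (star (χ r) * χ s) * ((t r : ℂ) * (t s : ℂ)) =
          if r = s then (q.totient : ℂ) * (t r : ℂ) ^ 2 else 0 := by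
        intro s
        rw [← Finset.sum_mul]
        have h3 := DirichletCharacter.sum_char_inv_mul_char_eq ℂ hr s
        have h4 : ∀ χ : DirichletCharacter ℂ q, star (χ r) = χ r⁻¹ := by
          intro χ
          rw [MulChar.star_apply', MulChar.inv_apply]
          congr 1
          obtain ⟨u, rfl⟩ := hr
          rw [Ring.inverse_unit]
          exact (ZMod.inv_coe_unit u).symm
        simp_rw [h4, h3]
        split_ifs with h
        · subst h; ring
        · simp
      simp_rw [h2]
      simp
    · refine Finset.sum_eq_zero fun s _ => Finset.sum_eq_zero fun χ _ => ?_
      simp [χ.map_nonunit hr]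
  have h5 : ∑ χ : DirichletCharacter ℂ q, ‖∑ r, χ r * (t r : ℂ)‖ ^ 2 =
      ∑ r : ZMod q, if IsUnit r then (q.totient : ℝ) * t r ^ 2 else 0 := by
    apply Complex.ofReal_injective
    rw [Complex.ofReal_sum, key, Complex.ofReal_sum]
    refine Finset.sum_congr rfl fun r _ => ?_
    split_ifs <;> simp
  rw [h5, Finset.mul_sum]
  refine Finset.sum_le_sum fun r _ => ?_
  split_ifs
  · exact le_rfl
  · positivity

lemma sum_range_mul_eq_sum_sum {E : Type*} [AddCommMonoid E] (h : ℕ → E) (q K : ℕ) :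
    ∑ j ∈ Finset.range (q * K), h j =
      ∑ i ∈ Finset.range q, ∑ k ∈ Finset.range K, h (i + q * k) := by
  induction K with
  | zero => simp
  | succ K ih =>
    rw [Nat.mul_succ, Finset.sum_range_add, ih, ← Finset.sum_add_distrib]
    refine Finset.sum_congr rfl fun i _ => ?_
    rw [Finset.sum_range_succ, add_comm i]

lemma sum_range_eq_sum_zmod {E : Type*} [AddCommMonoid E] {q : ℕ} [NeZero q] (h : ZMod q → E)
    (N : ℕ) : ∑ i ∈ Finset.range q, h ((N + i : ℕ) : ZMod q) = ∑ r, h r := by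
  refine Finset.sum_bij' (fun i _ => ((N + i : ℕ) : ZMod q)) (fun r _ => (r - N).val)
    ?_ ?_ ?_ ?_ ?_
  · simp
  · intro r _
    simpa using ZMod.val_lt _
  · intro i hi
    simp [ZMod.val_natCast, Nat.mod_eq_of_lt (Finset.mem_range.1 hi)]
  · intro r _
    simp
  · simp

/-- Mean square over nonprincipal characters of a character sum with nonincreasing weights. -/
lemma sum_norm_sq_antitone_le {q : ℕ} [NeZero q] {G : ℕ → ℝ} (hG : Antitone G)
    (hG0 : ∀ j, 0 ≤ G j) {M : ℕ} (hM : ∀ j, M ≤ j → G j = 0) (N : ℕ) :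
    ∑ χ ∈ Finset.univ.filter (fun χ : DirichletCharacter ℂ q => χ ≠ 1),
      ‖∑ j ∈ Finset.range M, χ ((N + j : ℕ) : ZMod q) * (G j : ℂ)‖ ^ 2 ≤
      q.totient * ∑ j ∈ Finset.range M, G j ^ 2 := by
  have hq : 0 < q := Nat.pos_of_ne_zero (NeZero.ne q)
  set A : ℕ → ℝ := fun i => ∑ k ∈ Finset.range M, G (i + q * k) with hA
  set t : ZMod q → ℝ := fun r => A (r - N).val - A (q - 1) with ht
  have ht_cast : ∀ i ∈ Finset.range q, t ((N + i : ℕ) : ZMod q) = A i - A (q - 1) := by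
    intro i hi
    simp [ht, ZMod.val_natCast, Nat.mod_eq_of_lt (Finset.mem_range.1 hi)]
  have hsum : ∀ χ : DirichletCharacter ℂ q, χ ≠ 1 →
      ∑ j ∈ Finset.range M, χ ((N + j : ℕ) : ZMod q) * (G j : ℂ) = ∑ r, χ r * (t r : ℂ) := by
    intro χ hχ
    have hsub : Finset.range M ⊆ Finset.range (q * M) := by
      apply Finset.range_subset_range.2
      exact Nat.le_mul_of_pos_left M hq
    rw [Finset.sum_subset hsub (by
      intro j _ hj
      rw [hM j (by simpa using hj)]
      simp), sum_range_mul_eq_sum_sum,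
      ← sum_range_eq_sum_zmod (fun r => χ r * (t r : ℂ)) N]
    have h0 : ∑ i ∈ Finset.range q, χ ((N + i : ℕ) : ZMod q) * (A (q - 1) : ℂ) = 0 := by
      rw [← Finset.sum_mul, sum_range_eq_sum_zmod (fun r => χ r) N,
        MulChar.sum_eq_zero_of_ne_one hχ, zero_mul]
    refine (sub_zero _).symm.trans ?_
    rw [← h0, ← Finset.sum_sub_distrib]
    refine Finset.sum_congr rfl fun i hi => ?_
    have h1 : ∑ k ∈ Finset.range M, χ ((N + (i + q * k) : ℕ) : ZMod q) * (G (i + q * k) : ℂ) =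
        χ ((N + i : ℕ) : ZMod q) * (A i : ℂ) := by
      rw [hA, Complex.ofReal_sum, Finset.mul_sum]
      refine Finset.sum_congr rfl fun k _ => ?_
      simp
    rw [ht_cast i hi, h1, Complex.ofReal_sub, mul_sub]
  have hbound : ∀ i ∈ Finset.range q, 0 ≤ A i - A (q - 1) ∧ A i - A (q - 1) ≤ G i := by
    intro i hi
    have hi' : i < q := Finset.mem_range.1 hi
    constructor
    · rw [sub_nonneg]
      exact Finset.sum_le_sum fun k _ => hG (by omega)
    · have h1 : A i ≤ ∑ k ∈ Finset.range (M + 1), G (i + q * k) :=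
        Finset.sum_le_sum_of_subset_of_nonneg (Finset.range_subset_range.2 (by omega))
          fun _ _ _ => hG0 _
      rw [Finset.sum_range_succ'] at h1
      have h2 : ∑ k ∈ Finset.range M, G (i + q * (k + 1)) ≤ A (q - 1) :=
        Finset.sum_le_sum fun k _ => hG (by rw [Nat.mul_succ]; omega)
      simp only [mul_zero, add_zero] at h1
      linarith
  calc _ = ∑ χ ∈ Finset.univ.filter (fun χ : DirichletCharacter ℂ q => χ ≠ 1),
        ‖∑ r, χ r * (t r : ℂ)‖ ^ 2 := by
        refine Finset.sum_congr rfl fun χ hχ => ?_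
        rw [hsum χ (Finset.mem_filter.1 hχ).2]
    _ ≤ ∑ χ : DirichletCharacter ℂ q, ‖∑ r, χ r * (t r : ℂ)‖ ^ 2 :=
        Finset.sum_le_sum_of_subset_of_nonneg (Finset.filter_subset _ _)
          fun _ _ _ => by positivity
    _ ≤ q.totient * ∑ r, t r ^ 2 := sum_norm_sq_dirichletCharacter_le t
    _ ≤ _ := by
        refine mul_le_mul_of_nonneg_left ?_ (Nat.cast_nonneg _)
        rw [← sum_range_eq_sum_zmod (fun r => t r ^ 2) N]
        calc _ ≤ ∑ i ∈ Finset.range q, G i ^ 2 := by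
              refine Finset.sum_le_sum fun i hi => ?_
              rw [ht_cast i hi]
              exact pow_le_pow_left₀ (hbound i hi).1 (hbound i hi).2 2
          _ ≤ ∑ i ∈ Finset.range (max q M), G i ^ 2 :=
              Finset.sum_le_sum_of_subset_of_nonneg
                (Finset.range_subset_range.2 (le_max_left _ _)) fun _ _ _ => by positivity
          _ = _ := by
              symm
              refine Finset.sum_subset (Finset.range_subset_range.2 (le_max_right _ _)) ?_
              intro j _ hj
              rw [hM j (by simpa using hj)]
              simp

lemma sum_Icc_ite_eq_sum_range {E : Type*} [AddCommMonoid E] (h : ℕ → E) {a b : ℝ} {d L : ℕ}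
    (hd : 0 < d) (ha : 0 ≤ a) (hbL : ⌊b⌋₊ ≤ L) :
    ∑ n ∈ Finset.Icc 1 L, (if a < ((n * d : ℕ) : ℝ) ∧ ((n * d : ℕ) : ℝ) ≤ b then h n else 0) =
      ∑ j ∈ Finset.range L, (if (((⌊a / d⌋₊ + 1 + j) * d : ℕ) : ℝ) ≤ b
        then h (⌊a / d⌋₊ + 1 + j) else 0) := by
  have hd' : (0 : ℝ) < d := by exact_mod_cast hd
  have hlow : ∀ n : ℕ, a < ((n * d : ℕ) : ℝ) ↔ ⌊a / d⌋₊ + 1 ≤ n := by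
    intro n
    rw [Nat.succ_le_iff, Nat.floor_lt (by positivity), div_lt_iff₀ hd']
    push_cast
    rfl
  rw [← Finset.sum_filter, ← Finset.sum_filter]
  refine Finset.sum_bij' (fun n _ => n - (⌊a / d⌋₊ + 1)) (fun j _ => ⌊a / d⌋₊ + 1 + j)
    ?_ ?_ ?_ ?_ ?_
  · intro n hn
    simp only [Finset.mem_filter, Finset.mem_Icc, Finset.mem_range, hlow] at hn ⊢
    refine ⟨by omega, ?_⟩
    rw [Nat.add_sub_cancel' hn.2.1]
    exact hn.2.2
  · intro j hj
    simp only [Finset.mem_filter, Finset.mem_Icc, Finset.mem_range, hlow] at hj ⊢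
    refine ⟨⟨by omega, ?_⟩, by omega, hj.2⟩
    exact (Nat.le_mul_of_pos_right _ hd).trans ((Nat.le_floor hj.2).trans hbL)
  · intro n hn
    simp only [Finset.mem_filter, hlow] at hn
    exact Nat.add_sub_cancel' hn.2.1
  · intro j _
    exact Nat.add_sub_cancel_left _ _
  · intro n hn
    simp only [Finset.mem_filter, hlow] at hn
    rw [Nat.add_sub_cancel' hn.2.1]

/-- For weights dominated by `n ^ (-1/2)`, the mean square over nonprincipal characters of a
character sum over the multiples of `d` in a subinterval of `[x, 3x]` is bounded. -/
lemma sum_norm_sq_interval_le {q : ℕ} [NeZero q] {g : ℕ → ℝ}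
    (hg : ∀ m n, 1 ≤ m → m ≤ n → g n ≤ g m) (hg0 : ∀ n, 0 ≤ g n)
    (hg2 : ∀ n : ℕ, 1 ≤ n → g n ^ 2 ≤ 1 / n) {x a b : ℝ} (hx : 0 < x) (hxa : x ≤ a)
    (hb : b ≤ 3 * x) {d : ℕ} (hd : 0 < d) :
    ∑ χ ∈ Finset.univ.filter (fun χ : DirichletCharacter ℂ q => χ ≠ 1),
      ‖∑ n ∈ Finset.Icc 1 ⌊3 * x⌋₊,
        (if a < ((n * d : ℕ) : ℝ) ∧ ((n * d : ℕ) : ℝ) ≤ b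
          then χ (n : ZMod q) * (g n : ℂ) else 0)‖ ^ 2 ≤ q.totient * 3 := by
  have ha : 0 ≤ a := hx.le.trans hxa
  have hd' : (0 : ℝ) < d := by exact_mod_cast hd
  have hbL : ⌊b⌋₊ ≤ ⌊3 * x⌋₊ := Nat.floor_mono hb
  set L := ⌊3 * x⌋₊ with hL
  set N := ⌊a / d⌋₊ + 1 with hN
  set G : ℕ → ℝ := fun j => if (((N + j) * d : ℕ) : ℝ) ≤ b then g (N + j) else 0 with hGdef
  have hG0 : ∀ j, 0 ≤ G j := by
    intro j
    simp only [hGdef]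
    split_ifs
    · exact hg0 _
    · exact le_rfl
  have hG : Antitone G := by
    intro i j hij
    simp only [hGdef]
    split_ifs with h1 h2 h2
    · exact hg _ _ (by omega) (by omega)
    · exact absurd (le_trans (by gcongr) h1) h2
    · exact hg0 _
    · exact le_rfl
  have hM : ∀ j, L ≤ j → G j = 0 := by
    intro j hj
    simp only [hGdef]
    refine if_neg fun h => ?_
    have := (Nat.le_mul_of_pos_right (N + j) hd).trans ((Nat.le_floor h).trans hbL)
    omega
  have hmain := sum_norm_sq_antitone_le (q := q) hG hG0 hM N
  have hsq : ∑ j ∈ Finset.range L, G j ^ 2 ≤ 3 := by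
    have h1 : ∑ j ∈ Finset.range L, G j ^ 2 = ∑ n ∈ Finset.Icc 1 L,
        (if a < ((n * d : ℕ) : ℝ) ∧ ((n * d : ℕ) : ℝ) ≤ b then g n ^ 2 else 0) := by
      rw [sum_Icc_ite_eq_sum_range (fun n => g n ^ 2) hd ha hbL]
      refine Finset.sum_congr rfl fun j _ => ?_
      simp only [hGdef]
      split_ifs <;> simp [hN]
    rw [h1, ← Finset.sum_filter]
    have hcard : ((Finset.filter (fun n : ℕ => a < ((n * d : ℕ) : ℝ) ∧ ((n * d : ℕ) : ℝ) ≤ b)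
        (Finset.Icc 1 L)).card : ℝ) ≤ 3 * x / d := by
      have hsub : Finset.filter (fun n : ℕ => a < ((n * d : ℕ) : ℝ) ∧ ((n * d : ℕ) : ℝ) ≤ b)
          (Finset.Icc 1 L) ⊆ Finset.Icc 1 ⌊3 * x / d⌋₊ := by
        intro n hn
        simp only [Finset.mem_filter, Finset.mem_Icc] at hn ⊢
        refine ⟨hn.1.1, Nat.le_floor ?_⟩
        rw [le_div_iff₀ hd']
        have := hn.2.2
        push_cast at this
        linarith
      have h2 := Finset.card_le_card hsub
      rw [Nat.card_Icc, Nat.add_sub_cancel] at h2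
      exact (Nat.cast_le.2 h2).trans (Nat.floor_le (by positivity))
    calc _ ≤ ∑ n ∈ Finset.filter (fun n : ℕ => a < ((n * d : ℕ) : ℝ) ∧ ((n * d : ℕ) : ℝ) ≤ b)
          (Finset.Icc 1 L), (d / x : ℝ) := by
          refine Finset.sum_le_sum fun n hn => ?_
          simp only [Finset.mem_filter, Finset.mem_Icc] at hn
          refine (hg2 n hn.1.1).trans ?_
          have hn0 : (0 : ℝ) < n := by exact_mod_cast hn.1.1
          rw [div_le_div_iff₀ hn0 hx]
          have := hn.2.1
          push_cast at this
          linarith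
      _ ≤ (3 * x / d) * (d / x) := by
          rw [Finset.sum_const, nsmul_eq_mul]
          exact mul_le_mul_of_nonneg_right hcard (by positivity)
      _ = 3 := by field_simp
  refine le_trans (le_of_eq ?_) (hmain.trans (mul_le_mul_of_nonneg_left hsq (Nat.cast_nonneg _)))
  refine Finset.sum_congr rfl fun χ _ => ?_
  rw [sum_Icc_ite_eq_sum_range (fun n => χ (n : ZMod q) * (g n : ℂ)) hd ha hbL]
  congr 2
  refine Finset.sum_congr rfl fun j _ => ?_
  simp only [hGdef]
  split_ifs <;> simp [hN]

lemma sum_norm_sq_rpow_le {q : ℕ} [NeZero q] {s : ℝ} (hs : 1 / 2 ≤ s) {x a b : ℝ} (hx : 0 < x)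
    (hxa : x ≤ a) (hb : b ≤ 3 * x) {d : ℕ} (hd : 0 < d) :
    ∑ χ ∈ Finset.univ.filter (fun χ : DirichletCharacter ℂ q => χ ≠ 1),
      ‖∑ n ∈ Finset.Icc 1 ⌊3 * x⌋₊,
        (if a < ((n * d : ℕ) : ℝ) ∧ ((n * d : ℕ) : ℝ) ≤ b
          then χ (n : ZMod q) * (((n : ℝ) ^ (-s) : ℝ) : ℂ) else 0)‖ ^ 2 ≤ q.totient * 3 := by
  refine sum_norm_sq_interval_le (g := fun n => (n : ℝ) ^ (-s)) ?_ ?_ ?_ hx hxa hb hd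
  · intro m n hm hmn
    have hm' : (0 : ℝ) < m := by exact_mod_cast hm
    exact Real.rpow_le_rpow_of_nonpos hm' (by exact_mod_cast hmn) (by linarith)
  · intro n
    positivity
  · intro n hn
    have hn' : (1 : ℝ) ≤ n := by exact_mod_cast hn
    rw [← Real.rpow_natCast, ← Real.rpow_mul (by positivity), one_div, ← Real.rpow_neg_one]
    refine Real.rpow_le_rpow_of_exponent_le hn' ?_
    push_cast
    linarith

lemma fm_eq_rpow {u : ℝ} (hu : 0 ≤ u) :
    fm u = zr (3 / 2) / 2 * u ^ (-(1 / 2 : ℝ)) + zr (2 / 3) / 3 * u ^ (-(2 / 3 : ℝ)) := by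
  rw [fm, Real.rpow_neg hu, Real.rpow_neg hu]
  simp only [div_eq_mul_inv, mul_inv]
  ring

lemma sum_norm_sq_fm_le {q : ℕ} [NeZero q] {x a b : ℝ} (hx : 0 < x) (hxa : x ≤ a)
    (hb : b ≤ 3 * x) {d : ℕ} (hd : 0 < d) :
    ∑ χ ∈ Finset.univ.filter (fun χ : DirichletCharacter ℂ q => χ ≠ 1),
      ‖∑ n ∈ Finset.Icc 1 ⌊3 * x⌋₊,
        (if a < ((n * d : ℕ) : ℝ) ∧ ((n * d : ℕ) : ℝ) ≤ b
          then χ (n : ZMod q) * (fm n : ℂ) else 0)‖ ^ 2 ≤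
      q.totient * (6 * ((zr (3 / 2) / 2) ^ 2 + (zr (2 / 3) / 3) ^ 2)) := by
  set α := zr (3 / 2) / 2
  set β := zr (2 / 3) / 3
  have h1 := sum_norm_sq_rpow_le (q := q) (s := 1 / 2) le_rfl hx hxa hb hd
  have h2 := sum_norm_sq_rpow_le (q := q) (s := 2 / 3) (by norm_num) hx hxa hb hd
  set T : ℝ → DirichletCharacter ℂ q → ℂ := fun s χ => ∑ n ∈ Finset.Icc 1 ⌊3 * x⌋₊,
        (if a < ((n * d : ℕ) : ℝ) ∧ ((n * d : ℕ) : ℝ) ≤ b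
          then χ (n : ZMod q) * (((n : ℝ) ^ (-s) : ℝ) : ℂ) else 0) with hT
  have h3 : ∀ χ : DirichletCharacter ℂ q, ‖∑ n ∈ Finset.Icc 1 ⌊3 * x⌋₊,
        (if a < ((n * d : ℕ) : ℝ) ∧ ((n * d : ℕ) : ℝ) ≤ b
          then χ (n : ZMod q) * (fm n : ℂ) else 0)‖ ^ 2 ≤
        2 * α ^ 2 * ‖T (1 / 2) χ‖ ^ 2 + 2 * β ^ 2 * ‖T (2 / 3) χ‖ ^ 2 := by
    intro χ
    have h4 : ∑ n ∈ Finset.Icc 1 ⌊3 * x⌋₊,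
        (if a < ((n * d : ℕ) : ℝ) ∧ ((n * d : ℕ) : ℝ) ≤ b
          then χ (n : ZMod q) * (fm n : ℂ) else 0) = α * T (1 / 2) χ + β * T (2 / 3) χ := by
      simp only [hT, Finset.mul_sum]
      rw [← Finset.sum_add_distrib]
      refine Finset.sum_congr rfl fun n _ => ?_
      split_ifs
      · rw [fm_eq_rpow (Nat.cast_nonneg n), Complex.ofReal_add, Complex.ofReal_mul,
          Complex.ofReal_mul]
        ring
      · simp
    rw [h4]
    have h5 := norm_add_le ((α : ℂ) * T (1 / 2) χ) (β * T (2 / 3) χ)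
    calc _ ≤ (‖(α : ℂ) * T (1 / 2) χ‖ + ‖(β : ℂ) * T (2 / 3) χ‖) ^ 2 :=
          pow_le_pow_left₀ (norm_nonneg _) h5 2
      _ ≤ 2 * (‖(α : ℂ) * T (1 / 2) χ‖ ^ 2 + ‖(β : ℂ) * T (2 / 3) χ‖ ^ 2) := add_sq_le
      _ = _ := by
          rw [norm_mul, norm_mul, mul_pow, mul_pow, Complex.norm_real, Complex.norm_real,
            Real.norm_eq_abs, Real.norm_eq_abs, sq_abs, sq_abs]
          ring
  refine (Finset.sum_le_sum fun χ _ => h3 χ).trans ?_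
  rw [Finset.sum_add_distrib, ← Finset.mul_sum, ← Finset.mul_sum]
  have h6 := mul_le_mul_of_nonneg_left h1 (by positivity : 0 ≤ 2 * α ^ 2)
  have h7 := mul_le_mul_of_nonneg_left h2 (by positivity : 0 ≤ 2 * β ^ 2)
  linarith

theorem stmt12 (ε : ℝ) (hε : ε ∈ Set.Ioo (0:ℝ) (1/1000)) :
    ∃ C : ℝ, 0 < C ∧ ∀ x : ℝ, 2 ≤ x → ∀ q : ℕ, ∀ hq : q.Prime, (q:ℝ) ≤ x ^ (1 - ε) →
      ∀ z : ℝ, 1 ≤ z → z ≤ 2*x → ∀ a b : ℝ, x ≤ a → a ≤ b → b ≤ 3*x →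
      haveI : NeZero q := ⟨hq.pos.ne'⟩
      (1 / (q.totient : ℝ)) *
          ∑ χ ∈ Finset.univ.filter (fun χ : DirichletCharacter ℂ q => χ ≠ 1),
            ‖∑ n ∈ Finset.Icc 1 ⌊3*x⌋₊, ∑ c ∈ Finset.Icc 1 ⌊3*x⌋₊,
                (if ((c:ℝ))^6 ≤ z ∧ a < ((n * c^6 : ℕ) : ℝ) ∧ ((n * c^6 : ℕ) : ℝ) ≤ b
                 then ((ArithmeticFunction.moebius c : ℤ) : ℂ) *
                     χ ((n : ℕ) : ZMod q) * (χ ((c : ℕ) : ZMod q)) ^ 6 * (fm n : ℂ)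
                 else 0)‖ ^ 2
      ≤ C * (z ^ ((1:ℝ)/3) + (b - a) ^ ((1:ℝ)/6) * (q:ℝ) ^ ((5:ℝ)/6)) * (Real.log x) ^ 6 := by
  set K : ℝ := 6 * ((zr (3 / 2) / 2) ^ 2 + (zr (2 / 3) / 3) ^ 2) with hK
  have hK0 : 0 ≤ K := by positivity
  have hlog2 : 0 < Real.log 2 := Real.log_pos one_lt_two
  refine ⟨K / Real.log 2 ^ 6 + 1, by positivity, ?_⟩
  intro x hx q hq _ z hz _ a b hxa hab hb
  have : NeZero q := ⟨hq.pos.ne'⟩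
  have hx0 : 0 < x := by linarith
  have hz0 : 0 ≤ z := by linarith
  have hφ : (0 : ℝ) < q.totient := by exact_mod_cast Nat.totient_pos.2 hq.pos
  set D := (Finset.Icc 1 ⌊3 * x⌋₊).filter (fun c : ℕ => (c : ℝ) ^ 6 ≤ z) with hD
  set T : ℕ → DirichletCharacter ℂ q → ℂ := fun c χ => ∑ n ∈ Finset.Icc 1 ⌊3 * x⌋₊,
    (if a < ((n * c ^ 6 : ℕ) : ℝ) ∧ ((n * c ^ 6 : ℕ) : ℝ) ≤ b
      then χ (n : ZMod q) * (fm n : ℂ) else 0) with hT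
  have hDcard : (D.card : ℝ) ≤ z ^ ((1 : ℝ) / 6) := by
    have hsub : D ⊆ Finset.Icc 1 ⌊z ^ ((1 : ℝ) / 6)⌋₊ := by
      intro c hc
      simp only [hD, Finset.mem_filter, Finset.mem_Icc] at hc ⊢
      refine ⟨hc.1.1, Nat.le_floor ?_⟩
      have h := Real.rpow_le_rpow (by positivity) hc.2 (by norm_num : (0 : ℝ) ≤ 1 / 6)
      rwa [← Real.rpow_natCast, ← Real.rpow_mul (Nat.cast_nonneg c),
        (by norm_num : ((6 : ℕ) : ℝ) * (1 / 6) = 1), Real.rpow_one] at h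
    have h := Finset.card_le_card hsub
    rw [Nat.card_Icc, Nat.add_sub_cancel] at h
    exact (Nat.cast_le.2 h).trans (Nat.floor_le (by positivity))
  have hDsq : (D.card : ℝ) ^ 2 ≤ z ^ ((1 : ℝ) / 3) := by
    calc _ ≤ (z ^ ((1 : ℝ) / 6)) ^ 2 := pow_le_pow_left₀ (Nat.cast_nonneg _) hDcard 2
      _ = _ := by
        rw [← Real.rpow_natCast, ← Real.rpow_mul hz0]
        norm_num
  have hmean : ∀ c ∈ D, ∑ χ ∈ Finset.univ.filter (fun χ : DirichletCharacter ℂ q => χ ≠ 1),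
      ‖T c χ‖ ^ 2 ≤ q.totient * K := by
    intro c hc
    simp only [hD, Finset.mem_filter, Finset.mem_Icc] at hc
    exact sum_norm_sq_fm_le hx0 hxa hb (pow_pos hc.1.1 6)
  have hpoint : ∀ χ : DirichletCharacter ℂ q,
      ‖∑ n ∈ Finset.Icc 1 ⌊3*x⌋₊, ∑ c ∈ Finset.Icc 1 ⌊3*x⌋₊,
        (if ((c:ℝ))^6 ≤ z ∧ a < ((n * c^6 : ℕ) : ℝ) ∧ ((n * c^6 : ℕ) : ℝ) ≤ b
          then ((ArithmeticFunction.moebius c : ℤ) : ℂ) *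
            χ ((n : ℕ) : ZMod q) * (χ ((c : ℕ) : ZMod q)) ^ 6 * (fm n : ℂ)
          else 0)‖ ^ 2 ≤ D.card * ∑ c ∈ D, ‖T c χ‖ ^ 2 := by
    intro χ
    have h1 : ∑ n ∈ Finset.Icc 1 ⌊3*x⌋₊, ∑ c ∈ Finset.Icc 1 ⌊3*x⌋₊,
        (if ((c:ℝ))^6 ≤ z ∧ a < ((n * c^6 : ℕ) : ℝ) ∧ ((n * c^6 : ℕ) : ℝ) ≤ b
          then ((ArithmeticFunction.moebius c : ℤ) : ℂ) *
            χ ((n : ℕ) : ZMod q) * (χ ((c : ℕ) : ZMod q)) ^ 6 * (fm n : ℂ)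
          else 0) = ∑ c ∈ D, ((ArithmeticFunction.moebius c : ℤ) : ℂ) *
            (χ ((c : ℕ) : ZMod q)) ^ 6 * T c χ := by
      rw [Finset.sum_comm, hD, Finset.sum_filter]
      refine Finset.sum_congr rfl fun c _ => ?_
      split_ifs with hc
      · simp only [hT, Finset.mul_sum, hc, true_and]
        refine Finset.sum_congr rfl fun n _ => ?_
        split_ifs
        · ring
        · simp
      · simp [hc]
    rw [h1]
    have h2 : ‖∑ c ∈ D, ((ArithmeticFunction.moebius c : ℤ) : ℂ) *
        (χ ((c : ℕ) : ZMod q)) ^ 6 * T c χ‖ ≤ ∑ c ∈ D, ‖T c χ‖ := by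
      refine (norm_sum_le _ _).trans (Finset.sum_le_sum fun c _ => ?_)
      rw [norm_mul, norm_mul, norm_pow]
      have h3 : ‖((ArithmeticFunction.moebius c : ℤ) : ℂ)‖ ≤ 1 := by
        rw [Complex.norm_intCast]
        exact_mod_cast ArithmeticFunction.abs_moebius_le_one
      have h4 : ‖χ ((c : ℕ) : ZMod q)‖ ^ 6 ≤ 1 :=
        pow_le_one₀ (norm_nonneg _) (DirichletCharacter.norm_le_one χ _)
      exact mul_le_of_le_one_left (norm_nonneg _)
        (mul_le_one₀ h3 (by positivity) h4)
    exact (pow_le_pow_left₀ (norm_nonneg _) h2 2).trans sq_sum_le_card_mul_sum_sq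
  have htotal : (1 / (q.totient : ℝ)) *
      ∑ χ ∈ Finset.univ.filter (fun χ : DirichletCharacter ℂ q => χ ≠ 1),
        (D.card * ∑ c ∈ D, ‖T c χ‖ ^ 2) ≤ K * z ^ ((1 : ℝ) / 3) := by
    rw [← Finset.mul_sum, Finset.sum_comm]
    have h1 := Finset.sum_le_sum hmean
    rw [Finset.sum_const, nsmul_eq_mul] at h1
    calc _ ≤ (1 / (q.totient : ℝ)) * (D.card * (D.card * (q.totient * K))) := by gcongr
      _ = K * (D.card : ℝ) ^ 2 := by field_simp
      _ ≤ _ := mul_le_mul_of_nonneg_left hDsq hK0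
  refine (mul_le_mul_of_nonneg_left (Finset.sum_le_sum fun χ _ => hpoint χ)
    (by positivity)).trans (htotal.trans ?_)
  have hlog : Real.log 2 ^ 6 ≤ Real.log x ^ 6 :=
    pow_le_pow_left₀ hlog2.le (Real.log_le_log two_pos hx) 6
  have hba : 0 ≤ b - a := sub_nonneg.2 hab
  calc K * z ^ ((1 : ℝ) / 3)
      = (K / Real.log 2 ^ 6) * (z ^ ((1 : ℝ) / 3)) * Real.log 2 ^ 6 := by field_simp
    _ ≤ _ := by
      have h1 : K / Real.log 2 ^ 6 ≤ K / Real.log 2 ^ 6 + 1 := by linarith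
      have h2 : z ^ ((1 : ℝ) / 3) ≤
          z ^ ((1 : ℝ) / 3) + (b - a) ^ ((1 : ℝ) / 6) * (q : ℝ) ^ ((5 : ℝ) / 6) :=
        le_add_of_nonneg_right (by positivity)
      gcongr
end

section
/- For every complex number s with Re(s) > −5/6, the absolutely convergent double series ∑_{c₁=1}^∞ ∑_{c₂=1}^∞ μ(c₁)·μ(c₂)·gcd(c₁,c₂)^{6−6s} / (c₁⁶·c₂⁶) equals the Euler product ∏_p ( 1 − 2·p^{−6} + p^{−6−6s} ) over all primes p. -/
open scoped Classical

/-- The general term of the double series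
`μ(c₁) μ(c₂) gcd(c₁,c₂)^(6-6s) / (c₁^6 c₂^6)` (set to `0` off the positive integers). -/
noncomputable def termF (s : ℂ) (c : ℕ × ℕ) : ℂ :=
  if 0 < c.1 ∧ 0 < c.2 then
    ((ArithmeticFunction.moebius c.1 : ℤ) : ℂ) * ((ArithmeticFunction.moebius c.2 : ℤ) : ℂ) *
      ((Nat.gcd c.1 c.2 : ℕ) : ℂ) ^ (6 - 6*s) / (((c.1 : ℂ)) ^ 6 * ((c.2 : ℂ)) ^ 6)
  else 0

/-- Expanding `∏ i ∈ S, (f i + g i + h i)` over the pairs of sets with union `S`. -/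
theorem Finset.sum_union_eq_prod {ι R : Type*} [DecidableEq ι] [CommSemiring R] (f g h : ι → R)
    (S : Finset ι) :
    ∑ c ∈ (S.powerset ×ˢ S.powerset).filter (fun c => c.1 ∪ c.2 = S),
      (∏ i ∈ c.1 \ c.2, f i) * (∏ i ∈ c.2 \ c.1, g i) * ∏ i ∈ c.1 ∩ c.2, h i
      = ∏ i ∈ S, (f i + g i + h i) := by
  have key : ∀ i, f i + g i + h i = (h i + f i) + g i := fun i => by ring
  simp_rw [key]
  rw [Finset.prod_add]
  simp_rw [Finset.prod_add, Finset.sum_mul]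
  rw [Finset.sum_sigma']
  refine Finset.sum_bij' (fun c _ => ⟨c.1, c.1 ∩ c.2⟩) (fun x _ => (x.1, x.2 ∪ S \ x.1))
    ?_ ?_ ?_ ?_ ?_
  · intro c hc
    simp only [Finset.mem_filter, Finset.mem_product, Finset.mem_powerset] at hc
    simp [hc.1.1]
  · rintro ⟨A, C⟩ hx
    simp only [Finset.mem_sigma, Finset.mem_powerset] at hx
    simp only [Finset.mem_filter, Finset.mem_product, Finset.mem_powerset]
    obtain ⟨h1, h2⟩ := hx
    refine ⟨⟨h1, ?_⟩, ?_⟩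
    · grind
    · grind
  · rintro ⟨A, B⟩ hc
    simp only [Finset.mem_filter, Finset.mem_product, Finset.mem_powerset] at hc
    ext x
    · rfl
    · grind
  · rintro ⟨A, C⟩ hx
    simp only [Finset.mem_sigma, Finset.mem_powerset] at hx
    have : A ∩ (C ∪ S \ A) = C := by grind
    simp [this]
  · rintro ⟨A, B⟩ hc
    simp only [Finset.mem_filter, Finset.mem_product, Finset.mem_powerset] at hc
    have e1 : A \ (A ∩ B) = A \ B := by grind
    have e2 : S \ A = B \ A := by grind
    simp only [e1, e2]
    ring

/-- The infinite product of `1 + (f i + g i + h i)` expanded over pairs of finite sets. -/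
theorem hasSum_finset_pair {ι : Type*} [DecidableEq ι] {f g h : ι → ℂ}
    (hf : Summable (‖f ·‖)) (hg : Summable (‖g ·‖)) (hh : Summable (‖h ·‖)) :
    HasSum (fun c : Finset ι × Finset ι =>
      (∏ i ∈ c.1 \ c.2, f i) * (∏ i ∈ c.2 \ c.1, g i) * ∏ i ∈ c.1 ∩ c.2, h i)
      (∏' i, (1 + (f i + g i + h i))) := by
  let e := Equiv.sigmaFiberEquiv (fun c : Finset ι × Finset ι => c.1 ∪ c.2)
  have fin : ∀ S : Finset ι, ∀ c : Finset ι × Finset ι, c.1 ∪ c.2 = S ↔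
      c ∈ (S.powerset ×ˢ S.powerset).filter (fun c => c.1 ∪ c.2 = S) := by
    intro S c
    simp only [Finset.mem_filter, Finset.mem_product, Finset.mem_powerset]
    grind
  have fiber : ∀ {R : Type} [NormedCommRing R] (f g h : ι → R) (S : Finset ι),
      HasSum (fun c : {c : Finset ι × Finset ι // c.1 ∪ c.2 = S} =>
      (∏ i ∈ c.1.1 \ c.1.2, f i) * (∏ i ∈ c.1.2 \ c.1.1, g i) * ∏ i ∈ c.1.1 ∩ c.1.2, h i)
      (∏ i ∈ S, (f i + g i + h i)) := by
    intro R _ f g h S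
    rw [← Finset.sum_union_eq_prod]
    rw [← (Equiv.subtypeEquivRight (fin S)).symm.hasSum_iff]
    exact Finset.hasSum _ _
  have hs : Summable (fun c : Finset ι × Finset ι =>
      (∏ i ∈ c.1 \ c.2, f i) * (∏ i ∈ c.2 \ c.1, g i) * ∏ i ∈ c.1 ∩ c.2, h i) := by
    refine Summable.of_norm ?_
    simp_rw [norm_mul, norm_prod]
    rw [← e.summable_iff,
      summable_sigma_of_nonneg (fun _ => by simp only [Function.comp]; positivity)]
    refine ⟨fun S => (fiber (‖f ·‖) (‖g ·‖) (‖h ·‖) S).summable, ?_⟩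
    have := summable_finsetProd_of_summable_nonneg (f := fun i => ‖f i‖ + ‖g i‖ + ‖h i‖)
      (fun i => by positivity) ((hf.add hg).add hh)
    refine this.congr fun S => ?_
    exact (fiber (‖f ·‖) (‖g ·‖) (‖h ·‖) S).tsum_eq.symm
  obtain ⟨a, ha⟩ := hs
  have h2 := (e.hasSum_iff.mpr ha).sigma (fun S => fiber f g h S)
  rw [(hasProd_one_add_of_hasSum_prod h2).tprod_eq]
  exact ha

/-- The product of a finite set of primes. -/
def primesProd (A : Finset Nat.Primes) : ℕ := ∏ p ∈ A, (p : ℕ)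

theorem primesProd_ne_zero (A : Finset Nat.Primes) : primesProd A ≠ 0 :=
  Finset.prod_ne_zero_iff.mpr fun p _ => p.2.ne_zero

theorem primesProd_injective : Function.Injective primesProd := by
  have key : ∀ A, (primesProd A).primeFactors =
      A.map ⟨fun p : Nat.Primes => (p : ℕ), Nat.Primes.coe_nat_injective⟩ := by
    intro A
    rw [← Nat.primeFactors_prod
      (s := A.map ⟨fun p : Nat.Primes => (p : ℕ), Nat.Primes.coe_nat_injective⟩), Finset.prod_map]
    · rfl
    · simp only [Finset.mem_map]
      rintro _ ⟨p, _, rfl⟩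
      exact p.2
  intro A B hAB
  have := congrArg Nat.primeFactors hAB
  rw [key, key] at this
  exact Finset.map_injective _ this

theorem exists_primesProd_eq {n : ℕ} (hn : Squarefree n) : ∃ A, primesProd A = n := by
  refine ⟨n.primeFactors.subtype Nat.Prime, ?_⟩
  conv_rhs => rw [← Nat.prod_primeFactors_of_squarefree hn]
  exact Finset.prod_subtype_of_mem (fun x => x) (fun x => Nat.prime_of_mem_primeFactors)

theorem primesProd_coprime {A B : Finset Nat.Primes} (h : Disjoint A B) :
    (primesProd A).Coprime (primesProd B) := by
  refine Nat.Coprime.prod_left fun p hp => Nat.Coprime.prod_right fun q hq => ?_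
  rw [Nat.coprime_primes p.2 q.2]
  intro e
  exact Finset.disjoint_left.mp h hp (Subtype.ext e ▸ hq)

theorem primesProd_sdiff_mul_inter (A B : Finset Nat.Primes) :
    primesProd (A \ B) * primesProd (A ∩ B) = primesProd A := by
  rw [mul_comm]
  exact Finset.prod_inter_mul_prod_sdiff A B _

theorem gcd_primesProd (A B : Finset Nat.Primes) :
    (primesProd A).gcd (primesProd B) = primesProd (A ∩ B) := by
  rw [← primesProd_sdiff_mul_inter A B, ← primesProd_sdiff_mul_inter B A, Finset.inter_comm B A,
    Nat.gcd_mul_right, Nat.Coprime.gcd_eq_one, one_mul]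
  exact primesProd_coprime disjoint_sdiff_sdiff

theorem moebius_primesProd (A : Finset Nat.Primes) :
    ArithmeticFunction.moebius (primesProd A) = ∏ _p ∈ A, (-1) := by
  rw [primesProd, ArithmeticFunction.isMultiplicative_moebius.map_prod]
  · exact Finset.prod_congr rfl fun p _ => ArithmeticFunction.moebius_apply_prime p.2
  · intro p _ q _ hpq
    exact (Nat.coprime_primes p.2 q.2).mpr fun e => hpq (Subtype.ext e)

theorem primesProd_cpow (A : Finset Nat.Primes) (z : ℂ) :
    ((primesProd A : ℕ) : ℂ) ^ z = ∏ p ∈ A, ((p : ℕ) : ℂ) ^ z := by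
  induction A using Finset.induction_on with
  | empty => simp [primesProd]
  | insert p A hp ih =>
    rw [Finset.prod_insert hp, ← ih, ← Complex.natCast_mul_natCast_cpow, ← Nat.cast_mul,
      primesProd, Finset.prod_insert hp, primesProd]

theorem termF_primesProd (s : ℂ) (A B : Finset Nat.Primes) :
    termF s (primesProd A, primesProd B) =
      (∏ p ∈ A \ B, (-(1 / ((p : ℕ) : ℂ) ^ 6))) * (∏ p ∈ B \ A, (-(1 / ((p : ℕ) : ℂ) ^ 6))) *
        ∏ p ∈ A ∩ B, ((p : ℕ) : ℂ) ^ (-6 - 6 * s) := by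
  have hinter : ∏ p ∈ A ∩ B, ((p : ℕ) : ℂ) ^ (-6 - 6 * s) = ∏ p ∈ A ∩ B,
      (-(1 / ((p : ℕ) : ℂ) ^ 6)) * (-(1 / ((p : ℕ) : ℂ) ^ 6)) * ((p : ℕ) : ℂ) ^ (6 - 6 * s) := by
    refine Finset.prod_congr rfl fun p _ => ?_
    have hp : ((p : ℕ) : ℂ) ≠ 0 := Nat.cast_ne_zero.mpr p.2.ne_zero
    rw [show 6 - 6 * s = (-6 - 6 * s) + (12 : ℕ) by push_cast; ring, Complex.cpow_add _ _ hp,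
      Complex.cpow_natCast]
    field_simp
  have hterm : ∀ A : Finset Nat.Primes,
      ((ArithmeticFunction.moebius (primesProd A) : ℤ) : ℂ) / ((primesProd A : ℕ) : ℂ) ^ 6 =
        (∏ p ∈ A, (-(1 / ((p : ℕ) : ℂ) ^ 6))) := by
    intro A
    rw [moebius_primesProd, primesProd]
    push_cast
    rw [← Finset.prod_pow, ← Finset.prod_div_distrib]
    exact Finset.prod_congr rfl fun p _ => by ring
  rw [termF, if_pos ⟨(primesProd_ne_zero A).bot_lt, (primesProd_ne_zero B).bot_lt⟩,
    mul_div_right_comm, mul_div_mul_comm, hterm, hterm, gcd_primesProd, primesProd_cpow, hinter,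
    Finset.prod_mul_distrib, Finset.prod_mul_distrib,
    ← Finset.prod_inter_mul_prod_sdiff A B, ← Finset.prod_inter_mul_prod_sdiff B A,
    Finset.inter_comm B A]
  ring

theorem stmt15 (s : ℂ) (hs : -5/6 < s.re) :
    Summable (termF s) ∧
    ∑' c : ℕ × ℕ, termF s c
      = ∏' p : Nat.Primes, (1 - 2 / ((p : ℕ) : ℂ) ^ 6 + ((p : ℕ) : ℂ) ^ (-6 - 6*s)) := by
  have h6 : Summable (fun p : Nat.Primes => ‖-(1 / ((p : ℕ) : ℂ) ^ 6)‖) := by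
    refine (Nat.Primes.summable_rpow.mpr (show (-6 : ℝ) < -1 by norm_num)).congr fun p => ?_
    rw [Real.rpow_neg (Nat.cast_nonneg _)]
    norm_num
  have hz : Summable (fun p : Nat.Primes => ‖((p : ℕ) : ℂ) ^ (-6 - 6 * s)‖) := by
    refine (Nat.Primes.summable_rpow.mpr
      (show (-6 - 6 * s.re : ℝ) < -1 by linarith)).congr fun p => ?_
    rw [Complex.norm_natCast_cpow_of_pos p.2.pos]
    simp
  have key := hasSum_finset_pair h6 h6 hz
  simp_rw [← termF_primesProd] at key
  have hinj : Function.Injective (Prod.map primesProd primesProd) :=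
    primesProd_injective.prodMap primesProd_injective
  have hsum := (hinj.hasSum_iff (f := termF s) (by
    rintro ⟨m, n⟩ hmn
    rw [termF]
    split_ifs with hpos
    · by_cases hm : Squarefree m
      · by_cases hn : Squarefree n
        · obtain ⟨A, rfl⟩ := exists_primesProd_eq hm
          obtain ⟨B, rfl⟩ := exists_primesProd_eq hn
          exact absurd ⟨(A, B), rfl⟩ hmn
        · simp [ArithmeticFunction.moebius_eq_zero_of_not_squarefree hn]
      · simp [ArithmeticFunction.moebius_eq_zero_of_not_squarefree hm]
    · rfl)).mp key
  refine ⟨hsum.summable, hsum.tsum_eq.trans (tprod_congr fun p => ?_)⟩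
  ring
end

section
/- Let q ≥ 2 be an integer, let α ∈ (ℤ/qℤ)^×, and let (b_n)_{n ≥ 1} be a finitely supported sequence of real numbers. Then (1/φ(q)) · ∑_{χ mod q, χ ≠ χ₀} ((1 + χ(α))/2) · | ∑_n b_n·χ(n) |² = ∑_{ℓ ∈ (ℤ/qℤ)^×} | (1/2)·( ∑_{n ≡ ℓ (mod q)} b_n + ∑_{n ≡ αℓ (mod q)} b_n ) − (1/φ(q))·∑_{gcd(n,q)=1} b_n |². -/
open scoped Classical

/-- Summing over the fibres of the residue map above the units picks out the terms whose residue
is a unit. -/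
lemma sum_units_sum_filter_natCast_eq {M : Type*} [AddCommMonoid M] {q : ℕ} [NeZero q]
    (s : Finset ℕ) (g : ℕ → M) :
    ∑ l : (ZMod q)ˣ, ∑ n ∈ s.filter (fun n : ℕ => (n : ZMod q) = (l : ZMod q)), g n =
      ∑ n ∈ s.filter (fun n => Nat.Coprime n q), g n := by
  simp only [Finset.sum_filter]
  rw [Finset.sum_comm]
  refine Finset.sum_congr rfl fun n _ => ?_
  simp only [← ZMod.isUnit_iff_coprime]
  split_ifs with h
  · obtain ⟨u, hu⟩ := h
    simp [← hu, Units.val_inj]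
  · exact Finset.sum_eq_zero fun l _ => if_neg fun hl : (n : ZMod q) = l => h (hl ▸ l.isUnit)

/-- A finite sum twisted by a Dirichlet character, grouped by residue classes. -/
lemma sum_mul_dirichletCharacter_eq_sum_units {q : ℕ} [NeZero q] (χ : DirichletCharacter ℂ q)
    (s : Finset ℕ) (b : ℕ → ℝ) :
    ∑ n ∈ s, (b n : ℂ) * χ (n : ZMod q) = ∑ l : (ZMod q)ˣ,
      ((∑ n ∈ s.filter (fun n : ℕ => (n : ZMod q) = (l : ZMod q)), b n : ℝ) : ℂ) *
        χ (l : ZMod q) := by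
  have h (l : (ZMod q)ˣ) :
      ((∑ n ∈ s.filter (fun n : ℕ => (n : ZMod q) = (l : ZMod q)), b n : ℝ) : ℂ) *
        χ (l : ZMod q) =
      ∑ n ∈ s.filter (fun n : ℕ => (n : ZMod q) = (l : ZMod q)), (b n : ℂ) * χ (n : ZMod q) := by
    rw [Complex.ofReal_sum, Finset.sum_mul]
    exact Finset.sum_congr rfl fun n hn => by rw [(Finset.mem_filter.mp hn).2]
  rw [Finset.sum_congr rfl fun l _ => h l, sum_units_sum_filter_natCast_eq, Finset.sum_filter]
  refine Finset.sum_congr rfl fun n _ => ?_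
  split_ifs with hn
  · rfl
  · rw [χ.map_nonunit (mt (ZMod.isUnit_iff_coprime n q).mp hn), mul_zero]

lemma DirichletCharacter.conj_apply_units {q : ℕ} [NeZero q] (χ : DirichletCharacter ℂ q)
    (u : (ZMod q)ˣ) :
    (starRingEnd ℂ) (χ (u : ZMod q)) = χ ((u⁻¹ : (ZMod q)ˣ) : ZMod q) := by
  have h := MulChar.star_apply' χ (u : ZMod q)
  rwa [MulChar.inv_apply, Ring.inverse_unit] at h

/-- Parseval's identity for Dirichlet characters, with a twist by `χ a`. -/
lemma sum_dirichletCharacter_apply_mul_norm_sq {q : ℕ} [NeZero q] (a : (ZMod q)ˣ)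
    (B : (ZMod q)ˣ → ℝ) :
    ∑ χ : DirichletCharacter ℂ q, χ (a : ZMod q) *
      ((‖∑ l : (ZMod q)ˣ, (B l : ℂ) * χ (l : ZMod q)‖ ^ 2 : ℝ) : ℂ) =
    q.totient * ((∑ l : (ZMod q)ˣ, B l * B (a * l) : ℝ) : ℂ) := by
  have key (χ : DirichletCharacter ℂ q) : χ (a : ZMod q) *
      ((‖∑ l : (ZMod q)ˣ, (B l : ℂ) * χ (l : ZMod q)‖ ^ 2 : ℝ) : ℂ) =
      ∑ l : (ZMod q)ˣ, ∑ m : (ZMod q)ˣ, (B l * B m : ℂ) *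
        χ ((a * l * m⁻¹ : (ZMod q)ˣ) : ZMod q) := by
    rw [Complex.ofReal_pow, ← Complex.mul_conj', map_sum, Finset.sum_mul_sum, Finset.mul_sum]
    refine Finset.sum_congr rfl fun l _ => ?_
    rw [Finset.mul_sum]
    refine Finset.sum_congr rfl fun m _ => ?_
    rw [map_mul, Complex.conj_ofReal, DirichletCharacter.conj_apply_units, Units.val_mul,
      Units.val_mul, map_mul, map_mul]
    ring
  simp only [key]
  rw [Finset.sum_comm, Complex.ofReal_sum, Finset.mul_sum]
  refine Finset.sum_congr rfl fun l _ => ?_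
  rw [Finset.sum_comm]
  simp only [← Finset.mul_sum, DirichletCharacter.sum_characters_eq, Units.val_eq_one,
    mul_inv_eq_one]
  simp
  ring

/-- The squared deviation from the mean of the average of `B` with its translate by `a`. -/
lemma sum_sq_average_sub_mean {G : Type*} [Group G] [Fintype G] (a : G) (B : G → ℝ) :
    ∑ l, ((1 / 2) * (B l + B (a * l)) - (1 / (Fintype.card G : ℝ)) * ∑ m, B m) ^ 2 =
      (∑ l, B l * B l + ∑ l, B l * B (a * l)) / 2 -
        (1 / (Fintype.card G : ℝ)) * (∑ m, B m) ^ 2 := by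
  have h₁ : ∑ l, B (a * l) = ∑ l, B l := Equiv.sum_comp (Equiv.mulLeft a) B
  have h₂ : ∑ l, B (a * l) * B (a * l) = ∑ l, B l * B l :=
    Equiv.sum_comp (Equiv.mulLeft a) fun l => B l * B l
  have hc : (Fintype.card G : ℝ) ≠ 0 := by simp
  generalize hT : ∑ m, B m = T at h₁ ⊢
  generalize hN : 1 / (Fintype.card G : ℝ) = N
  have hN' : (Fintype.card G : ℝ) * N = 1 := by rw [← hN]; field_simp
  have expand (l : G) : ((1 / 2) * (B l + B (a * l)) - N * T) ^ 2 =
      1 / 4 * (B l * B l) + 1 / 4 * (B (a * l) * B (a * l)) + 1 / 2 * (B l * B (a * l)) -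
        N * T * B l - N * T * B (a * l) + (N * T) ^ 2 := by ring
  simp only [expand, Finset.sum_add_distrib, Finset.sum_sub_distrib, ← Finset.mul_sum, h₁, h₂, hT,
    Finset.sum_const, Finset.card_univ, nsmul_eq_mul]
  linear_combination N * T ^ 2 * hN'

theorem stmt16 (q : ℕ) (hq : 2 ≤ q) (α : (ZMod q)ˣ) (b : ℕ →₀ ℝ) (hb : b 0 = 0) :
    haveI : NeZero q := ⟨by omega⟩
    (1 / (q.totient : ℂ)) *
        ∑ χ ∈ Finset.univ.filter (fun χ : DirichletCharacter ℂ q => χ ≠ 1),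
          ((1 + χ ((α : ZMod q))) / 2) *
            ((‖∑ n ∈ b.support, (b n : ℂ) * χ ((n : ZMod q))‖ ^ 2 : ℝ) : ℂ)
      = ((∑ ℓ : (ZMod q)ˣ,
          |(1/2) * ((∑ n ∈ b.support.filter (fun n : ℕ => ((n : ℕ) : ZMod q) = (ℓ : ZMod q)), b n) +
                    (∑ n ∈ b.support.filter
                        (fun n : ℕ => ((n : ℕ) : ZMod q) = (α : ZMod q) * (ℓ : ZMod q)), b n)) -
            (1 / (q.totient : ℝ)) * ∑ n ∈ b.support.filter (fun n => Nat.Coprime n q), b n| ^ 2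
          : ℝ) : ℂ) := by
  have : NeZero q := ⟨by omega⟩
  set B : (ZMod q)ˣ → ℝ := fun l =>
    ∑ n ∈ b.support.filter (fun n : ℕ => (n : ZMod q) = (l : ZMod q)), b n
  have hq0 : (q.totient : ℂ) ≠ 0 := by
    exact_mod_cast (Nat.totient_pos.mpr (by omega : 0 < q)).ne'
  have hR := sum_sq_average_sub_mean α B
  rw [ZMod.card_units_eq_totient] at hR
  have hT : ∑ m, B m = ∑ n ∈ b.support.filter (fun n => Nat.Coprime n q), b n :=
    sum_units_sum_filter_natCast_eq _ _
  have hone := sum_dirichletCharacter_apply_mul_norm_sq (1 : (ZMod q)ˣ) B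
  have hα := sum_dirichletCharacter_apply_mul_norm_sq α B
  simp only [Units.val_one, map_one, one_mul] at hone
  have hsum : ∑ χ : DirichletCharacter ℂ q, ((1 + χ (α : ZMod q)) / 2) *
      ((‖∑ l : (ZMod q)ˣ, (B l : ℂ) * χ (l : ZMod q)‖ ^ 2 : ℝ) : ℂ) =
      q.totient * (((∑ l, B l * B l + ∑ l, B l * B (α * l)) / 2 : ℝ) : ℂ) := by
    calc _ = (1 / 2) * (∑ χ : DirichletCharacter ℂ q,
            ((‖∑ l : (ZMod q)ˣ, (B l : ℂ) * χ (l : ZMod q)‖ ^ 2 : ℝ) : ℂ) +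
          ∑ χ : DirichletCharacter ℂ q, χ (α : ZMod q) *
            ((‖∑ l : (ZMod q)ˣ, (B l : ℂ) * χ (l : ZMod q)‖ ^ 2 : ℝ) : ℂ)) := by
          rw [← Finset.sum_add_distrib, Finset.mul_sum]
          exact Finset.sum_congr rfl fun χ _ => by ring
      _ = _ := by
          rw [hone, hα]
          push_cast
          ring
  have hprincipal : ((1 + (1 : DirichletCharacter ℂ q) (α : ZMod q)) / 2) *
      ((‖∑ l : (ZMod q)ˣ, (B l : ℂ) * (1 : DirichletCharacter ℂ q) (l : ZMod q)‖ ^ 2 : ℝ) : ℂ) =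
      (((∑ m, B m) ^ 2 : ℝ) : ℂ) := by
    simp only [MulChar.one_apply_coe, mul_one, ← Complex.ofReal_sum, Complex.norm_real,
      Real.norm_eq_abs, sq_abs]
    ring
  rw [← Finset.add_sum_erase _ _ (Finset.mem_univ (1 : DirichletCharacter ℂ q)), hprincipal]
    at hsum
  simp only [sq_abs, ← Units.val_mul, ← hT, sum_mul_dirichletCharacter_eq_sum_units,
    Finset.filter_ne']
  refine Eq.trans ?_ (congrArg Complex.ofReal hR.symm)
  rw [← eq_sub_iff_add_eq'] at hsum
  rw [hsum]
  push_cast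
  field_simp
end
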